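/- arXiv:0709.3810 — 3 statements merged into one kernel-verified Lean document; each statement's English description precedes it below -/
import Mathlib

section
/- Let m, n > 1 be integers and let R = (r_1, …, r_m) and C = (c_1, …, c_n) be positive integer vectors with r_1 + … + r_m = c_1 + … + c_n = N. Then the function F(x, y) = (∏_{i=1}^m x_i^{-r_i}) (∏_{j=1}^n y_j^{-c_j}) ∏_{i,j} 1/(1 - x_i y_j) attains its minimum over the open cube {0 < x_i < 1 for i = 1, …, m, 0 < y_j < 1 for j = 1, …, n}; that is, there exists a point (x*, y*) with all coordinates strictly between 0 and 1 such that F(x*, y*) ≤ F(x, y) for all (x, y) in the open cube. -/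
/-- The function `∏ x_i^{-r_i} ∏ y_j^{-c_j} ∏_{i,j} (1 - x_i y_j)⁻¹`. -/
noncomputable def contingencyF {m n : ℕ} (r : Fin m → ℕ) (c : Fin n → ℕ)
    (x : Fin m → ℝ) (y : Fin n → ℝ) : ℝ :=
  (∏ i, x i ^ (-(r i : ℤ))) * (∏ j, y j ^ (-(c j : ℤ))) * (∏ i, ∏ j, (1 - x i * y j)⁻¹)

theorem one_le_prod_real {ι : Type*} {s : Finset ι} {f : ι → ℝ} (h : ∀ i ∈ s, 1 ≤ f i) :
    1 ≤ ∏ i ∈ s, f i := by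
  simpa using Finset.prod_le_prod (f := fun _ => (1 : ℝ)) (fun _ _ => zero_le_one) h

theorem le_prod_real_of_one_le {ι : Type*} {s : Finset ι} {f : ι → ℝ} (h : ∀ i ∈ s, 1 ≤ f i)
    {a : ι} (ha : a ∈ s) : f a ≤ ∏ i ∈ s, f i := by
  classical
  rw [← Finset.mul_prod_erase s f ha]
  exact le_mul_of_one_le_right (zero_le_one.trans (h a ha))
    (one_le_prod_real fun i hi => h i (Finset.mem_of_mem_erase hi))

theorem inv_le_zpow_neg {a : ℝ} (h : a ∈ Set.Ioo (0 : ℝ) 1) {k : ℕ} (hk : 0 < k) :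
    a⁻¹ ≤ a ^ (-(k : ℤ)) := by
  rw [zpow_neg, zpow_natCast]
  exact inv_anti₀ (pow_pos h.1 k) (pow_le_of_le_one h.1.le h.2.le hk.ne')

theorem one_le_inv_one_sub_mul {a b : ℝ} (ha : a ∈ Set.Ioo (0 : ℝ) 1)
    (hb : b ∈ Set.Ioo (0 : ℝ) 1) : 1 ≤ (1 - a * b)⁻¹ := by
  have := mul_pos ha.1 hb.1
  have := mul_lt_one_of_nonneg_of_lt_one_left ha.1.le ha.2 hb.2.le
  exact (one_le_inv₀ (by linarith)).2 (by linarith)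

/-- On the open cube every factor of `contingencyF` is at least `1`, hence is bounded by it. -/
theorem factors_le_contingencyF {m n : ℕ} {r : Fin m → ℕ} {c : Fin n → ℕ}
    (hr : ∀ i, 0 < r i) (hc : ∀ j, 0 < c j) {x : Fin m → ℝ} {y : Fin n → ℝ}
    (hx : ∀ i, x i ∈ Set.Ioo (0 : ℝ) 1) (hy : ∀ j, y j ∈ Set.Ioo (0 : ℝ) 1) :
    (∀ i, (x i)⁻¹ ≤ contingencyF r c x y) ∧ (∀ j, (y j)⁻¹ ≤ contingencyF r c x y) ∧
      ∀ i j, (1 - x i * y j)⁻¹ ≤ contingencyF r c x y := by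
  have hx1 : ∀ i ∈ Finset.univ, 1 ≤ x i ^ (-(r i : ℤ)) := fun i _ =>
    ((one_le_inv₀ (hx i).1).2 (hx i).2.le).trans (inv_le_zpow_neg (hx i) (hr i))
  have hy1 : ∀ j ∈ Finset.univ, 1 ≤ y j ^ (-(c j : ℤ)) := fun j _ =>
    ((one_le_inv₀ (hy j).1).2 (hy j).2.le).trans (inv_le_zpow_neg (hy j) (hc j))
  have hxy1 : ∀ i, ∀ j ∈ Finset.univ, 1 ≤ (1 - x i * y j)⁻¹ := fun i j _ =>
    one_le_inv_one_sub_mul (hx i) (hy j)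
  have hrow : ∀ i ∈ Finset.univ, 1 ≤ ∏ j, (1 - x i * y j)⁻¹ := fun i _ =>
    one_le_prod_real (hxy1 i)
  have hA := one_le_prod_real hx1
  have hB := one_le_prod_real hy1
  have hC := one_le_prod_real hrow
  have hAF : ∏ i, x i ^ (-(r i : ℤ)) ≤ contingencyF r c x y :=
    (le_mul_of_one_le_right (by linarith) hB).trans
      (le_mul_of_one_le_right (by positivity) hC)
  have hBF : ∏ j, y j ^ (-(c j : ℤ)) ≤ contingencyF r c x y :=
    (le_mul_of_one_le_left (by linarith) hA).trans
      (le_mul_of_one_le_right (by positivity) hC)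
  have hCF : ∏ i, ∏ j, (1 - x i * y j)⁻¹ ≤ contingencyF r c x y :=
    le_mul_of_one_le_left (by linarith) (one_le_mul_of_one_le_of_one_le hA hB)
  refine ⟨fun i => ?_, fun j => ?_, fun i j => ?_⟩
  · exact (inv_le_zpow_neg (hx i) (hr i)).trans
      ((le_prod_real_of_one_le hx1 (Finset.mem_univ i)).trans hAF)
  · exact (inv_le_zpow_neg (hy j) (hc j)).trans
      ((le_prod_real_of_one_le hy1 (Finset.mem_univ j)).trans hBF)
  · exact (le_prod_real_of_one_le (hxy1 i) (Finset.mem_univ j)).trans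
      ((le_prod_real_of_one_le hrow (Finset.mem_univ i)).trans hCF)

theorem contingencyF_smul_inv_smul {m n : ℕ} {r : Fin m → ℕ} {c : Fin n → ℕ}
    (h : ∑ i, r i = ∑ j, c j) (x : Fin m → ℝ) (y : Fin n → ℝ) {t : ℝ} (ht : t ≠ 0) :
    contingencyF r c (fun i => t * x i) (fun j => t⁻¹ * y j) = contingencyF r c x y := by
  have hxy : ∀ i j, t * x i * (t⁻¹ * y j) = x i * y j := fun i j => by field_simp
  simp only [contingencyF, hxy, zpow_neg, zpow_natCast, mul_pow, mul_inv,
    Finset.prod_mul_distrib, Finset.prod_inv_distrib, Finset.prod_pow_eq_pow_sum, h, inv_pow]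
  field_simp

/-- Pairs with coordinates in `[M⁻¹, 1]` and all products `x_i y_j` at most `1 - M⁻¹`. -/
def marginBox (m n : ℕ) (M : ℝ) : Set ((Fin m → ℝ) × (Fin n → ℝ)) :=
  Set.Icc (fun _ => M⁻¹, fun _ => M⁻¹) (fun _ => 1, fun _ => 1) ∩
    {p | ∀ i j, p.1 i * p.2 j ≤ 1 - M⁻¹}

theorem isCompact_marginBox (m n : ℕ) (M : ℝ) : IsCompact (marginBox m n M) := by
  refine isCompact_Icc.inter_right ?_
  simp only [Set.ofPred_forall]
  exact isClosed_iInter fun i => isClosed_iInter fun j =>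
    isClosed_le (by fun_prop) continuous_const

theorem continuousOn_contingencyF_marginBox {m n : ℕ} (r : Fin m → ℕ) (c : Fin n → ℕ)
    {M : ℝ} (hM : 0 < M) :
    ContinuousOn (fun p : (Fin m → ℝ) × (Fin n → ℝ) => contingencyF r c p.1 p.2)
      (marginBox m n M) := by
  have hM' := inv_pos.2 hM
  unfold contingencyF
  refine ((continuousOn_finsetProd _ fun i _ => ?_).mul
    (continuousOn_finsetProd _ fun j _ => ?_)).mul
    (continuousOn_finsetProd _ fun i _ => continuousOn_finsetProd _ fun j _ => ?_)
  · exact ContinuousOn.zpow₀ (by fun_prop) _ fun p hp => Or.inl (hM'.trans_le (hp.1.1.1 i)).ne'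
  · exact ContinuousOn.zpow₀ (by fun_prop) _ fun p hp => Or.inl (hM'.trans_le (hp.1.1.2 j)).ne'
  · refine ContinuousOn.inv₀ (by fun_prop) fun p hp => ?_
    have := hp.2 i j
    linarith

theorem mem_marginBox_of_contingencyF_le {m n : ℕ} {r : Fin m → ℕ} {c : Fin n → ℕ}
    (hr : ∀ i, 0 < r i) (hc : ∀ j, 0 < c j) {x : Fin m → ℝ} {y : Fin n → ℝ}
    (hx : ∀ i, x i ∈ Set.Ioo (0 : ℝ) 1) (hy : ∀ j, y j ∈ Set.Ioo (0 : ℝ) 1)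
    {M : ℝ} (hF : contingencyF r c x y ≤ M) : (x, y) ∈ marginBox m n M := by
  obtain ⟨h1, h2, h3⟩ := factors_le_contingencyF hr hc hx hy
  refine ⟨⟨⟨fun i => ?_, fun j => ?_⟩, fun i => (hx i).2.le, fun j => (hy j).2.le⟩, fun i j => ?_⟩
  · exact inv_le_of_inv_le₀ (hx i).1 ((h1 i).trans hF)
  · exact inv_le_of_inv_le₀ (hy j).1 ((h2 j).trans hF)
  · have hlt := mul_lt_one_of_nonneg_of_lt_one_left (hx i).1.le (hx i).2 (hy j).2.le
    have := inv_le_of_inv_le₀ (sub_pos.2 hlt) ((h3 i j).trans hF)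
    change x i * y j ≤ 1 - M⁻¹
    linarith

/-- If all products `x_i y_j` are below `1`, rescaling moves `(x, y)` into the open cube. -/
theorem exists_rescale_mem_Ioo {m n : ℕ} [NeZero m] [NeZero n] {x : Fin m → ℝ} {y : Fin n → ℝ}
    (hx : ∀ i, 0 < x i) (hy : ∀ j, 0 < y j) (hxy : ∀ i j, x i * y j < 1) :
    ∃ t : ℝ, 0 < t ∧ (∀ i, t * x i ∈ Set.Ioo (0 : ℝ) 1) ∧
      ∀ j, t⁻¹ * y j ∈ Set.Ioo (0 : ℝ) 1 := by
  obtain ⟨i₀, hi₀⟩ := Finite.exists_max x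
  obtain ⟨j₀, hj₀⟩ := Finite.exists_max y
  obtain ⟨t, ht1, ht2⟩ := exists_between
    (show y j₀ < (x i₀)⁻¹ by rw [← one_div, lt_div_iff₀ (hx i₀), mul_comm]; exact hxy i₀ j₀)
  have ht : 0 < t := (hy j₀).trans ht1
  refine ⟨t, ht, fun i => ⟨mul_pos ht (hx i), ?_⟩, fun j => ⟨mul_pos (inv_pos.2 ht) (hy j), ?_⟩⟩
  · calc t * x i ≤ t * x i₀ := mul_le_mul_of_nonneg_left (hi₀ i) ht.le
      _ < 1 := by rwa [← lt_div_iff₀ (hx i₀), one_div]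
  · rw [inv_mul_lt_one₀ ht]
    exact (hj₀ j).trans_lt ht1


/-- For positive integer margins `R = (r_1, …, r_m)`,
`C = (c_1, …, c_n)` with equal total sum `N`, the function
`F(x,y) = (∏ x_i^{-r_i}) (∏ y_j^{-c_j}) ∏_{i,j} (1 - x_i y_j)⁻¹`
attains its minimum on the open cube `0 < x_i, y_j < 1`. -/
theorem contingency_F_attains_min
    (m n N : ℕ) (hm : 1 < m) (hn : 1 < n)
    (r : Fin m → ℕ) (c : Fin n → ℕ)
    (hr : ∀ i, 0 < r i) (hc : ∀ j, 0 < c j)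
    (hrN : ∑ i, r i = N) (hcN : ∑ j, c j = N) :
    ∃ (x : Fin m → ℝ) (y : Fin n → ℝ),
      (∀ i, x i ∈ Set.Ioo (0 : ℝ) 1) ∧ (∀ j, y j ∈ Set.Ioo (0 : ℝ) 1) ∧
      ∀ (x' : Fin m → ℝ) (y' : Fin n → ℝ),
        (∀ i, x' i ∈ Set.Ioo (0 : ℝ) 1) → (∀ j, y' j ∈ Set.Ioo (0 : ℝ) 1) →
        (∏ i, x i ^ (-(r i : ℤ))) * (∏ j, y j ^ (-(c j : ℤ))) *
            (∏ i, ∏ j, (1 - x i * y j)⁻¹) ≤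
          (∏ i, x' i ^ (-(r i : ℤ))) * (∏ j, y' j ^ (-(c j : ℤ))) *
            (∏ i, ∏ j, (1 - x' i * y' j)⁻¹) := by
  have : NeZero m := ⟨by omega⟩
  have : NeZero n := ⟨by omega⟩
  change ∃ x y, _ ∧ _ ∧ ∀ x' y', _ → _ → contingencyF r c x y ≤ contingencyF r c x' y'
  have hhalf : (1 / 2 : ℝ) ∈ Set.Ioo (0 : ℝ) 1 := by constructor <;> norm_num
  set M := contingencyF r c (fun _ => 1 / 2) (fun _ => 1 / 2) with hMdef
  have hM : 0 < M := (inv_pos.2 hhalf.1).trans_le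
    ((factors_le_contingencyF hr hc (fun _ => hhalf) (fun _ => hhalf)).1 0)
  have hmem := mem_marginBox_of_contingencyF_le hr hc (fun _ => hhalf) (fun _ => hhalf) hMdef.ge
  obtain ⟨⟨x, y⟩, hp, hmin⟩ := (isCompact_marginBox m n M).exists_isMinOn ⟨_, hmem⟩
    (continuousOn_contingencyF_marginBox r c hM)
  have hM' := inv_pos.2 hM
  obtain ⟨t, ht, htx, hty⟩ := exists_rescale_mem_Ioo (fun i => hM'.trans_le (hp.1.1.1 i))
    (fun j => hM'.trans_le (hp.1.1.2 j)) fun i j => (hp.2 i j).trans_lt (by linarith)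
  refine ⟨fun i => t * x i, fun j => t⁻¹ * y j, htx, hty, fun x' y' hx' hy' => ?_⟩
  rw [contingencyF_smul_inv_smul (hrN.trans hcN.symm) x y ht.ne']
  rcases le_total (contingencyF r c x' y') M with hle | hle
  · exact hmin (mem_marginBox_of_contingencyF_le hr hc hx' hy' hle)
  · exact (hmin hmem).trans hle
end

section
/- Let m, n > 1 be integers and let R = (r_1, …, r_m) and C = (c_1, …, c_n) be positive integer vectors with r_1 + … + r_m = c_1 + … + c_n = N. Then the number #(R, C) of m × n nonnegative integer matrices with row sums R and column sums C satisfies #(R, C) ≤ F(x, y) for every x = (x_1, …, x_m) and y = (y_1, …, y_n) with 0 < x_i, y_j < 1 for all i, j; in particular #(R, C) ≤ ρ(R, C), the minimum of F over the open cube. -/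
/-- A truncated geometric series with ratio in `[0, 1)` is bounded by the full one. -/
theorem geom_sum_le_inv_one_sub {t : ℝ} (h0 : 0 ≤ t) (h1 : t < 1) (k : ℕ) :
    ∑ a ∈ Finset.range k, t ^ a ≤ (1 - t)⁻¹ := by
  rw [← tsum_geometric_of_lt_one h0 h1]
  exact (summable_geometric_of_lt_one h0 h1).sum_le_tsum _ fun a _ => pow_nonneg h0 a

/-- The monomial of a matrix in the products `x i * y j` depends only on its margins. -/
theorem prod_mul_pow_eq_of_margins {ι κ M : Type*} [Fintype ι] [Fintype κ] [CommMonoid M]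
    (x : ι → M) (y : κ → M) {r : ι → ℕ} {c : κ → ℕ} {D : ι → κ → ℕ}
    (hr : ∀ i, ∑ j, D i j = r i) (hc : ∀ j, ∑ i, D i j = c j) :
    ∏ i, ∏ j, (x i * y j) ^ D i j = (∏ i, x i ^ r i) * ∏ j, y j ^ c j := by
  simp only [mul_pow, Finset.prod_mul_distrib]
  congr 1
  · simp only [Finset.prod_pow_eq_pow_sum, hr]
  · rw [Finset.prod_comm]
    simp only [Finset.prod_pow_eq_pow_sum, hc]

/-- The generating function bound for contingency tables, with denominators cleared. -/
theorem card_margins_mul_le {ι κ : Type*} [Fintype ι] [Fintype κ]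
    (r : ι → ℕ) (c : κ → ℕ) {x : ι → ℝ} {y : κ → ℝ}
    (hx : ∀ i, x i ∈ Set.Ioo (0 : ℝ) 1) (hy : ∀ j, y j ∈ Set.Ioo (0 : ℝ) 1) :
    (Nat.card {D : Matrix ι κ ℕ // (∀ i, ∑ j, D i j = r i) ∧ (∀ j, ∑ i, D i j = c j)} : ℝ) *
      ((∏ i, x i ^ r i) * ∏ j, y j ^ c j) ≤ ∏ i, ∏ j, (1 - x i * y j)⁻¹ := by
  classical
  have hpos : ∀ i j, 0 ≤ x i * y j := fun i j => (mul_pos (hx i).1 (hy j).1).le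
  have hlt : ∀ i j, x i * y j < 1 := fun i j =>
    mul_lt_one_of_nonneg_of_lt_one_left (hx i).1.le (hx i).2 (hy j).2.le
  let T : Finset (ι → κ → ℕ) :=
    Fintype.piFinset fun i => Fintype.piFinset fun _ => Finset.range (r i + 1)
  let S : Finset (ι → κ → ℕ) :=
    T.filter fun D => (∀ i, ∑ j, D i j = r i) ∧ (∀ j, ∑ i, D i j = c j)
  have hS : ∀ D : ι → κ → ℕ,
      D ∈ S ↔ (∀ i, ∑ j, D i j = r i) ∧ (∀ j, ∑ i, D i j = c j) := by
    intro D
    simp only [S, T, Finset.mem_filter, Fintype.mem_piFinset, Finset.mem_range,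
      and_iff_right_iff_imp]
    intro h i j
    rw [Nat.lt_succ_iff, ← h.1 i]
    exact Finset.single_le_sum (f := fun j => D i j) (fun _ _ => Nat.zero_le _)
      (Finset.mem_univ j)
  have hcard : Nat.card {D : Matrix ι κ ℕ //
      (∀ i, ∑ j, D i j = r i) ∧ (∀ j, ∑ i, D i j = c j)} = S.card :=
    Nat.subtype_card S hS
  calc
    _ = ∑ D ∈ S, ∏ i, ∏ j, (x i * y j) ^ D i j := by
      rw [hcard, ← nsmul_eq_mul, ← Finset.sum_const]
      refine Finset.sum_congr rfl fun D hD => ?_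
      rw [prod_mul_pow_eq_of_margins x y ((hS D).1 hD).1 ((hS D).1 hD).2]
    _ ≤ ∑ D ∈ T, ∏ i, ∏ j, (x i * y j) ^ D i j :=
      Finset.sum_le_sum_of_subset_of_nonneg (Finset.filter_subset _ _) fun D _ _ =>
        Finset.prod_nonneg fun i _ => Finset.prod_nonneg fun j _ => pow_nonneg (hpos i j) _
    _ = ∏ i, ∏ j, ∑ a ∈ Finset.range (r i + 1), (x i * y j) ^ a := by
      simp only [Finset.prod_univ_sum, T]
    _ ≤ ∏ i, ∏ j, (1 - x i * y j)⁻¹ :=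
      Finset.prod_le_prod
        (fun i _ => Finset.prod_nonneg fun j _ =>
          Finset.sum_nonneg fun a _ => pow_nonneg (hpos i j) a)
        fun i _ => Finset.prod_le_prod
          (fun j _ => Finset.sum_nonneg fun a _ => pow_nonneg (hpos i j) a)
          fun j _ => geom_sum_le_inv_one_sub (hpos i j) (hlt i j) _

/-- The number `#(R,C)` of `m × n` nonnegative integer matrices with
row sums `R` and column sums `C` satisfies `#(R,C) ≤ F(x,y)` for every point `(x,y)` of
the open cube `0 < x_i, y_j < 1`; in particular `#(R,C) ≤ ρ(R,C)`, the minimum of `F`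
over the open cube. -/
theorem contingency_count_le_F
    (m n N : ℕ) (hm : 1 < m) (hn : 1 < n)
    (r : Fin m → ℕ) (c : Fin n → ℕ)
    (hr : ∀ i, 0 < r i) (hc : ∀ j, 0 < c j)
    (hrN : ∑ i, r i = N) (hcN : ∑ j, c j = N)
    (ρ : ℝ)
    (hρ : IsLeast {z : ℝ | ∃ (x : Fin m → ℝ) (y : Fin n → ℝ),
      (∀ i, x i ∈ Set.Ioo (0 : ℝ) 1) ∧ (∀ j, y j ∈ Set.Ioo (0 : ℝ) 1) ∧
      (∏ i, x i ^ (-(r i : ℤ))) * (∏ j, y j ^ (-(c j : ℤ))) *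
        (∏ i, ∏ j, (1 - x i * y j)⁻¹) = z} ρ) :
    (∀ (x : Fin m → ℝ) (y : Fin n → ℝ),
      (∀ i, x i ∈ Set.Ioo (0 : ℝ) 1) → (∀ j, y j ∈ Set.Ioo (0 : ℝ) 1) →
      (Nat.card {D : Matrix (Fin m) (Fin n) ℕ //
          (∀ i, ∑ j, D i j = r i) ∧ (∀ j, ∑ i, D i j = c j)} : ℝ) ≤
        (∏ i, x i ^ (-(r i : ℤ))) * (∏ j, y j ^ (-(c j : ℤ))) *
          (∏ i, ∏ j, (1 - x i * y j)⁻¹)) ∧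
    (Nat.card {D : Matrix (Fin m) (Fin n) ℕ //
        (∀ i, ∑ j, D i j = r i) ∧ (∀ j, ∑ i, D i j = c j)} : ℝ) ≤ ρ := by
  have bound : ∀ (x : Fin m → ℝ) (y : Fin n → ℝ),
      (∀ i, x i ∈ Set.Ioo (0 : ℝ) 1) → (∀ j, y j ∈ Set.Ioo (0 : ℝ) 1) →
      (Nat.card {D : Matrix (Fin m) (Fin n) ℕ //
          (∀ i, ∑ j, D i j = r i) ∧ (∀ j, ∑ i, D i j = c j)} : ℝ) ≤
        (∏ i, x i ^ (-(r i : ℤ))) * (∏ j, y j ^ (-(c j : ℤ))) *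
          (∏ i, ∏ j, (1 - x i * y j)⁻¹) := by
    intro x y hx hy
    have hpos : 0 < (∏ i, x i ^ r i) * ∏ j, y j ^ c j :=
      mul_pos (Finset.prod_pos fun i _ => pow_pos (hx i).1 _)
        (Finset.prod_pos fun j _ => pow_pos (hy j).1 _)
    simp only [zpow_neg, zpow_natCast, Finset.prod_inv_distrib (f := fun i => x i ^ r i),
      Finset.prod_inv_distrib (f := fun j => y j ^ c j)]
    rw [← mul_inv, le_inv_mul_iff₀ hpos, mul_comm]
    exact card_margins_mul_le r c hx hy
  refine ⟨bound, ?_⟩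
  obtain ⟨x, y, hx, hy, hxy⟩ := hρ.1
  exact hxy ▸ bound x y hx hy
end

section
/- Let m, n > 1 be integers with m + n ≥ 10 and let R = (r_1, …, r_m) and C = (c_1, …, c_n) be positive integer vectors with r_1 + … + r_m = c_1 + … + c_n = N. Then #(R, C) ≥ [Γ((m+n)/2) / (2 e^5 π^{(m+n-2)/2} m n (N+mn))] · (2 / ((mn)^2 (N+1)(N+mn)))^{m+n-1} · (∏_{i=1}^m r_i^{r_i}/r_i!) · (∏_{j=1}^n c_j^{c_j}/c_j!) · [N! (N+mn)! (mn)^{mn}] / [N^N (N+mn)^{N+mn} (mn)!] · ρ(R, C). -/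
open Real

/-- A symmetric bilinear form with no positive definite plane, stated as a reverse
Cauchy–Schwarz inequality. -/
def IsLorentz {E : Type*} [AddCommGroup E] [Module ℝ E] (B : LinearMap.BilinForm ℝ E) : Prop :=
  ∀ u w, 0 < B u u → B u u * B w w ≤ B u w ^ 2

section Lorentz

variable {E : Type*} [AddCommGroup E] [Module ℝ E]

lemma IsLorentz.of_hyperplane {B : LinearMap.BilinForm ℝ E} (hB : ∀ u w, B u w = B w u)
    (l : E →ₗ[ℝ] ℝ) (h : ∀ w, l w = 0 → B w w ≤ 0) : IsLorentz B := by
  intro u w hu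
  have hlu : l u ≠ 0 := fun h0 => absurd (h u h0) (not_le.mpr hu)
  have key := h (w - (l w / l u) • u) (by simp [hlu])
  simp only [map_sub, map_smul, LinearMap.sub_apply, LinearMap.smul_apply, smul_eq_mul] at key
  rw [hB w u] at key
  nlinarith [sq_nonneg (B u w - (l w / l u) * B u u), mul_le_mul_of_nonneg_left key hu.le]

/-- A Lorentzian form is nonpositive on the orthogonal complement of a vector outside the
kernel on which the form is nonnegative. -/
lemma IsLorentz.nonpos_of_orthogonal {B : LinearMap.BilinForm ℝ E} (hL : IsLorentz B)
    (hB : ∀ u w, B u w = B w u) {x w : E} (hx : 0 ≤ B x x) (hx' : ∃ u, B u x ≠ 0)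
    (hw : B w x = 0) : B w w ≤ 0 := by
  by_contra! hpos
  obtain ⟨u, hu⟩ := hx'
  set v := u - (B u w / B w w) • w with hv
  have hvx : B x v ≠ 0 := by
    rw [hB]; simpa [hv, hw] using hu
  have hvw : B w v = 0 := by
    simp only [hv, map_sub, map_smul, smul_eq_mul]
    rw [hB w u]; field_simp; ring
  have h1 : ∀ s : ℝ, B x x + 2 * s * B x v + s ^ 2 * B v v ≤ 0 := by
    intro s
    have := hL w (x + s • v) hpos
    simp only [map_add, map_smul, LinearMap.add_apply, LinearMap.smul_apply, smul_eq_mul,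
      hvw, hw, hB v x] at this
    by_contra! h2
    nlinarith [mul_pos hpos h2]
  have ha := sq_nonneg (B v v)
  have hb : 0 < B x v ^ 2 := by positivity
  have h2 := h1 (B x v / (1 + B v v ^ 2))
  have hd : 0 < 1 + B v v ^ 2 := by positivity
  have h3 : 0 < 2 * (B x v / (1 + B v v ^ 2)) * B x v +
      (B x v / (1 + B v v ^ 2)) ^ 2 * B v v := by
    have : 2 * (B x v / (1 + B v v ^ 2)) * B x v + (B x v / (1 + B v v ^ 2)) ^ 2 * B v v =
      B x v ^ 2 / (1 + B v v ^ 2) ^ 2 * (2 * (1 + B v v ^ 2) + B v v) := by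
      field_simp
    rw [this]
    have : 0 < 2 * (1 + B v v ^ 2) + B v v := by nlinarith [sq_nonneg (B v v + 1)]
    positivity
  linarith

/-- Two Lorentzian forms linked by `N ea = y (M + N) eb` have a Lorentzian sum. -/
lemma IsLorentz.add_of_link {M N : LinearMap.BilinForm ℝ E} (hM : IsLorentz M)
    (hN : IsLorentz N) (hMs : ∀ u w, M u w = M w u) (hNs : ∀ u w, N u w = N w u)
    {a b : E} {y : ℝ} (hy : 0 < y) (hlink : ∀ w, N w a = y * (M w b + N w b))
    (hMab : 0 ≤ M a b) (hMbb : 0 ≤ M b b) (hNab : 0 ≤ N a b) (hNbb : 0 ≤ N b b)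
    (hMN : ∃ w, M w b + N w b ≠ 0) (hMker : ∃ w, M w b ≠ 0) : IsLorentz (M + N) := by
  refine IsLorentz.of_hyperplane (fun u w => by simp [hMs u w, hNs u w]) ((M + N).flip b) ?_
  intro w hw
  change M w b + N w b = 0 at hw
  change M w w + N w w ≤ 0
  have hwa : N w a = 0 := by rw [hlink, hw, mul_zero]
  have hNwb : N w b = - M w b := by linarith
  have hB1 : N a a = y * (M a b + N a b) := hlink a
  have hB2 : N a b = y * (M b b + N b b) := by rw [hNs]; exact hlink b
  have hNaa : 0 ≤ N a a := by rw [hB1]; positivity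
  have hNker : ∃ u, N u a ≠ 0 := by
    obtain ⟨u, hu⟩ := hMN
    exact ⟨u, by rw [hlink]; exact mul_ne_zero hy.ne' hu⟩
  have key : ∀ t : ℝ, N w w ≤ 2 * t * M w b + t ^ 2 * M b b := by
    intro t
    have hs : ∃ s : ℝ, s * N a a + t * N a b = 0 ∧ s * t * N a b + t ^ 2 * (M b b + N b b) ≥ 0 := by
      rcases hNaa.eq_or_lt with h0 | h0
      · have : N a b = 0 := by
          rw [hB1] at h0
          nlinarith [mul_nonneg hy.le hMab, mul_nonneg hy.le hNab]
        refine ⟨0, by simp [this, ← h0], ?_⟩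
        simp only [zero_mul, zero_add]; positivity
      · refine ⟨- t * N a b / N a a, by field_simp; ring, ?_⟩
        have h1 : N a b * N a b / N a a ≤ M b b + N b b := by
          rw [div_le_iff₀ h0]
          nth_rewrite 1 [hB2]
          nlinarith [mul_nonneg hy.le (mul_nonneg (add_nonneg hMbb hNbb) hMab)]
        have : - t * N a b / N a a * t * N a b = - t ^ 2 * (N a b * N a b / N a a) := by ring
        rw [this]
        nlinarith [sq_nonneg t]
    obtain ⟨s, hs1, hs2⟩ := hs
    have h := hN.nonpos_of_orthogonal hNs (x := a) (w := w + s • a + t • b) hNaa hNker (by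
      simp only [map_add, map_smul, LinearMap.add_apply, LinearMap.smul_apply, smul_eq_mul,
        hwa, hNs b a]
      linarith)
    simp only [map_add, map_smul, LinearMap.add_apply, LinearMap.smul_apply, smul_eq_mul,
        hwa, hNs b a, hNs a w, hNs b w, hNwb] at h
    have : s * (s * N a a + t * N a b) = 0 := by rw [hs1, mul_zero]
    nlinarith
  rcases hMbb.eq_or_lt with h0 | h0
  · rw [← h0] at key
    have hc : M w b = 0 := by
      by_contra hc
      have h := key ((N w w - 1) / (2 * M w b))
      have h' : 2 * ((N w w - 1) / (2 * M w b)) * M w b = N w w - 1 := by field_simp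
      rw [h', mul_zero] at h
      linarith
    have h1 := hM.nonpos_of_orthogonal hMs (x := b) (w := w) h0.le hMker hc
    have h2 := key 0
    simp at h2
    linarith
  · have h1 := key (- M w b / M b b)
    have h2 := hM b w h0
    rw [hMs b w] at h2
    have h3 : 2 * (- M w b / M b b) * M w b + (- M w b / M b b) ^ 2 * M b b =
      - (M w b ^ 2 / M b b) := by field_simp; ring
    have h4 : M w w ≤ M w b ^ 2 / M b b := by rw [le_div_iff₀ h0]; linarith
    linarith

end Lorentz

section Network

variable {ι κ : Type*} [Fintype ι] [Fintype κ] [DecidableEq ι] [DecidableEq κ]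

/-- Points with nonnegative row coordinates, nonpositive column coordinates and total zero. -/
def Feasible (α : ι ⊕ κ → ℤ) : Prop :=
  (∀ i, 0 ≤ α (.inl i)) ∧ (∀ l, α (.inr l) ≤ 0) ∧ ∑ v, α v = 0

/-- The bilinear form with matrix `F (α + e_j + e_k)`. -/
noncomputable def hess (F : (ι ⊕ κ → ℤ) → ℝ) (α : ι ⊕ κ → ℤ) :
    LinearMap.BilinForm ℝ (ι ⊕ κ → ℝ) :=
  Matrix.toBilin' (Matrix.of fun j k => F (α + Pi.single j 1 + Pi.single k 1))

/-- Functions on the lattice supported exactly on the feasible points, all of whose forms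
`hess F α` with nonnegative row coordinates are Lorentzian. -/
structure IsLorentzFun (F : (ι ⊕ κ → ℤ) → ℝ) : Prop where
  pos : ∀ α, Feasible α → 0 < F α
  zero : ∀ α, ¬ Feasible α → F α = 0
  lorentz : ∀ α, (∀ i, 0 ≤ α (.inl i)) → IsLorentz (hess F α)

/-- The margins of the table with a single unit entry at `(i, l)`, columns counted negatively. -/
def arc (i : ι) (l : κ) : ι ⊕ κ → ℤ := Pi.single (.inl i) 1 - Pi.single (.inr l) 1

/-- Multiplication by the geometric series in `y` times the shift by `arc i l`. -/
noncomputable def pushArc (i : ι) (l : κ) (y : ℝ) (F : (ι ⊕ κ → ℤ) → ℝ) (α : ι ⊕ κ → ℤ) : ℝ :=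
  ∑ k ∈ Finset.range ((α (.inl i)).toNat + 1), y ^ k * F (α - k • arc i l)

lemma hess_single (F : (ι ⊕ κ → ℤ) → ℝ) (α : ι ⊕ κ → ℤ) (j k : ι ⊕ κ) :
    hess F α (Pi.single j 1) (Pi.single k 1) = F (α + Pi.single j 1 + Pi.single k 1) := by
  simp [hess]

lemma hess_apply (F : (ι ⊕ κ → ℤ) → ℝ) (α : ι ⊕ κ → ℤ) (u w : ι ⊕ κ → ℝ) :
    hess F α u w = ∑ j, ∑ k, u j * F (α + Pi.single j 1 + Pi.single k 1) * w k := by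
  simp [hess, Matrix.toBilin'_apply]

lemma hess_apply_single (F : (ι ⊕ κ → ℤ) → ℝ) (α : ι ⊕ κ → ℤ) (u : ι ⊕ κ → ℝ) (k : ι ⊕ κ) :
    hess F α u (Pi.single k 1) = ∑ j, u j * F (α + Pi.single j 1 + Pi.single k 1) := by
  rw [hess_apply]
  refine Finset.sum_congr rfl fun j _ => ?_
  simp [Pi.single_apply]

lemma hess_symm (F : (ι ⊕ κ → ℤ) → ℝ) (α : ι ⊕ κ → ℤ) (u w : ι ⊕ κ → ℝ) :
    hess F α u w = hess F α w u := by
  rw [hess_apply, hess_apply, Finset.sum_comm]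
  refine Finset.sum_congr rfl fun j _ => Finset.sum_congr rfl fun k _ => ?_
  rw [add_right_comm]; ring

lemma IsLorentzFun.nonneg {F : (ι ⊕ κ → ℤ) → ℝ} (hF : IsLorentzFun F) (α) : 0 ≤ F α := by
  by_cases h : Feasible α
  · exact (hF.pos α h).le
  · exact (hF.zero α h).ge

omit [Fintype ι] [Fintype κ] in
@[simp] lemma arc_inl (i i' : ι) (l : κ) :
    arc i l (.inl i') = if i' = i then 1 else 0 := by
  simp [arc, Pi.single_apply]

omit [Fintype ι] [Fintype κ] in
@[simp] lemma arc_inr (i : ι) (l l' : κ) :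
    arc i l (.inr l') = if l' = l then -1 else 0 := by
  simp only [arc, Pi.sub_apply, Pi.single_apply]
  simp; split_ifs <;> simp

lemma sum_arc (i : ι) (l : κ) : ∑ v, arc i l v = 0 := by
  simp [arc]

lemma Feasible.of_sub_arc {α : ι ⊕ κ → ℤ} {i : ι} {l : κ} {k : ℕ}
    (h : Feasible (α - k • arc i l)) : Feasible α := by
  obtain ⟨h1, h2, h3⟩ := h
  refine ⟨fun i' => ?_, fun l' => ?_, ?_⟩
  · have := h1 i'
    simp at this
    split_ifs at this <;> omega
  · have := h2 l'
    simp at this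
    split_ifs at this <;> omega
  · simpa [Finset.sum_sub_distrib, ← Finset.mul_sum, sum_arc] using h3

lemma pushArc_eq (i : ι) (l : κ) (y : ℝ) {F : (ι ⊕ κ → ℤ) → ℝ}
    (hF : ∀ α, ¬ Feasible α → F α = 0) (α : ι ⊕ κ → ℤ) :
    pushArc i l y F α = F α + y * pushArc i l y F (α - arc i l) := by
  by_cases h : 1 ≤ α (.inl i)
  · obtain ⟨k, hk⟩ : ∃ k : ℕ, α (.inl i) = k + 1 := ⟨(α (.inl i) - 1).toNat, by omega⟩
    have h1 : (α (.inl i)).toNat = k + 1 := by omega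
    have h2 : ((α - arc i l) (.inl i)).toNat = k := by simp [hk]
    rw [pushArc, pushArc, h1, h2, Finset.sum_range_succ', Finset.mul_sum, add_comm]
    congr 1
    · simp
    · refine Finset.sum_congr rfl fun k _ => ?_
      rw [succ_nsmul', sub_add_eq_sub_sub]; ring
  · have h3 : pushArc i l y F (α - arc i l) = 0 := by
      have h2 : ((α - arc i l) (.inl i)).toNat = 0 := by simp; omega
      rw [pushArc, h2]
      simp only [zero_add, Finset.range_one, Finset.sum_singleton, pow_zero, zero_smul, sub_zero,
        one_mul]
      exact hF _ fun h' => by have := h'.1 i; simp at this; omega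
    rw [h3, mul_zero, add_zero, pushArc]
    by_cases h0 : α (.inl i) = 0
    · simp [h0]
    · have h2 : (α (.inl i)).toNat = 0 := by omega
      simp [h2]

lemma IsLorentz.smul {E : Type*} [AddCommGroup E] [Module ℝ E] {B : LinearMap.BilinForm ℝ E}
    (hB : IsLorentz B) {y : ℝ} (hy : 0 < y) : IsLorentz (y • B) := by
  intro u w hu
  simp only [LinearMap.smul_apply, smul_eq_mul] at hu ⊢
  have h := hB u w (pos_of_mul_pos_right hu hy.le)
  nlinarith [mul_le_mul_of_nonneg_left h (sq_nonneg y)]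

/-- If the form of `G = F + y G(· - arc)` pairs trivially with the column of the arc, then the
shifted form vanishes. -/
lemma hess_sub_arc_eq_zero {G : (ι ⊕ κ → ℤ) → ℝ} (hpos : ∀ α, Feasible α → 0 < G α)
    (hzero : ∀ α, ¬ Feasible α → G α = 0) (i : ι) (l : κ) {α : ι ⊕ κ → ℤ}
    (hα : ∀ i, 0 ≤ α (.inl i)) (h : ∀ j, G (α + Pi.single j 1 + Pi.single (.inr l) 1) = 0) :
    hess G (α - arc i l) = 0 := by
  refine LinearMap.ext fun u => LinearMap.ext fun w => ?_
  rw [hess_apply]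
  refine Finset.sum_eq_zero fun j _ => Finset.sum_eq_zero fun k _ => ?_
  rw [hzero, mul_zero, zero_mul]
  rintro ⟨h1, h2, h3⟩
  refine (hpos (α + Pi.single k 1 + Pi.single (.inr l) 1) ⟨?_, ?_, ?_⟩).ne' (h k)
  · intro i'
    have := hα i'
    simp [Pi.single_apply]; split_ifs <;> omega
  · intro l'
    have := h2 l'
    simp [Pi.single_apply] at this ⊢
    split_ifs at * <;> omega
  · simp only [Pi.add_apply, Pi.sub_apply, Finset.sum_add_distrib, Finset.sum_sub_distrib, sum_arc,
      Finset.sum_pi_single', Finset.mem_univ, if_true] at h3 ⊢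
    simpa using h3

lemma IsLorentzFun.pushArc {F : (ι ⊕ κ → ℤ) → ℝ} (hF : IsLorentzFun F) (i : ι) (l : κ)
    {y : ℝ} (hy : 0 < y) : IsLorentzFun (pushArc i l y F) := by
  have hpos : ∀ α, Feasible α → 0 < _root_.pushArc i l y F α := by
    intro α hα
    refine Finset.sum_pos' (fun k _ => mul_nonneg (by positivity) (hF.nonneg _)) ⟨0, by simp, ?_⟩
    simpa using hF.pos α hα
  have hzero : ∀ α, ¬ Feasible α → _root_.pushArc i l y F α = 0 := by
    intro α hα
    refine Finset.sum_eq_zero fun k _ => ?_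
    rw [hF.zero _ fun h => hα h.of_sub_arc, mul_zero]
  have hnonneg : ∀ α, 0 ≤ _root_.pushArc i l y F α := fun α => by
    by_cases h : Feasible α
    · exact (hpos α h).le
    · exact (hzero α h).ge
  have hrec := pushArc_eq i l y hF.zero
  set G := _root_.pushArc i l y F with hG
  refine ⟨hpos, hzero, ?_⟩
  have hstep : ∀ α : ι ⊕ κ → ℤ, (∀ i, 0 ≤ α (.inl i)) → IsLorentz (hess G (α - arc i l)) →
      IsLorentz (hess G α) := by
    intro α hα hL
    have hsum : hess G α = hess F α + y • hess G (α - arc i l) := by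
      refine LinearMap.ext fun u => LinearMap.ext fun w => ?_
      simp only [LinearMap.add_apply, LinearMap.smul_apply, smul_eq_mul, hess_apply,
        Finset.mul_sum, ← Finset.sum_add_distrib]
      refine Finset.sum_congr rfl fun j _ => Finset.sum_congr rfl fun k _ => ?_
      rw [hrec, show α + Pi.single j 1 + Pi.single k 1 - arc i l =
        α - arc i l + Pi.single j 1 + Pi.single k 1 by abel]
      ring
    by_cases hb : ∀ j, G (α + Pi.single j 1 + Pi.single (.inr l) 1) = 0
    · rw [hsum, hess_sub_arc_eq_zero hpos hzero i l hα hb, smul_zero, add_zero]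
      exact hF.lorentz α hα
    · push Not at hb
      obtain ⟨j, hj⟩ := hb
      rw [hsum]
      have hshift : α - arc i l + Pi.single (.inl i) 1 = α + Pi.single (.inr l) 1 := by
        simp only [arc]; abel
      refine (hF.lorentz α hα).add_of_link (hL.smul hy) (hess_symm F α)
        (fun u w => by simp [hess_symm G _ u w]) (a := Pi.single (.inl i) 1)
        (b := Pi.single (.inr l) 1) hy ?_ ?_ ?_ ?_ ?_ ?_ ?_
      · intro w
        have h := congrArg (fun B => B w (Pi.single (.inr l) 1)) hsum
        simp only [LinearMap.add_apply] at h
        rw [← h]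
        simp only [LinearMap.smul_apply, smul_eq_mul, hess_apply_single]
        refine congrArg _ (Finset.sum_congr rfl fun k _ => ?_)
        rw [add_right_comm, hshift, add_right_comm]
      · rw [hess_single]; exact hF.nonneg _
      · rw [hess_single]; exact hF.nonneg _
      · simp only [LinearMap.smul_apply, smul_eq_mul, hess_single]
        exact mul_nonneg hy.le (hnonneg _)
      · simp only [LinearMap.smul_apply, smul_eq_mul, hess_single]
        exact mul_nonneg hy.le (hnonneg _)
      · refine ⟨Pi.single j 1, ?_⟩
        have h := congrArg (fun B => B (Pi.single j 1) (Pi.single (.inr l) 1)) hsum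
        simp only [LinearMap.add_apply] at h
        rw [← h, hess_single]
        exact hj
      · refine ⟨Pi.single j 1, ?_⟩
        rw [hess_single]
        exact (hF.pos _ (by_contra fun h => hj (hzero _ h))).ne'
  suffices H : ∀ (K : ℕ) (α : ι ⊕ κ → ℤ), (∀ i, 0 ≤ α (.inl i)) → α (.inl i) = K →
      IsLorentz (hess G α) from fun α hα =>
    H (α (.inl i)).toNat α hα (by have := hα i; omega)
  intro K
  induction K with
  | zero =>
    intro α hα h0
    refine hstep α hα (IsLorentz.of_hyperplane (hess_symm G _)
      (LinearMap.proj (Sum.inl i)) fun w hw => ?_)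
    rw [LinearMap.proj_apply] at hw
    rw [hess_apply]
    refine (Finset.sum_eq_zero fun j _ => Finset.sum_eq_zero fun k _ => ?_).le
    by_cases hj : j = .inl i
    · simp [hj, hw]
    by_cases hk : k = .inl i
    · simp [hk, hw]
    rw [hzero, mul_zero, zero_mul]
    intro h
    have := h.1 i
    simp [Ne.symm hj, Ne.symm hk, h0] at this
  | succ K ih =>
    intro α hα hK
    refine hstep α hα (ih _ (fun i' => ?_) (by simp [hK]))
    have := hα i'
    by_cases h : i' = i
    · subst h; simp [hK]
    · simpa [h] using this

open Classical in
/-- The indicator of feasibility, penalised by `ε` per unit of row coordinate. -/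
noncomputable def slackFun (ε : ℝ) (α : ι ⊕ κ → ℤ) : ℝ :=
  if Feasible α then ε ^ (∑ i, (α (.inl i)).toNat) else 0

omit [Fintype κ] in
lemma sum_toNat_add_single {α : ι ⊕ κ → ℤ} (hα : ∀ i, 0 ≤ α (.inl i)) (j : ι ⊕ κ) :
    ∑ i, ((α + Pi.single j 1 : ι ⊕ κ → ℤ) (.inl i)).toNat =
      ∑ i, (α (.inl i)).toNat + Sum.elim (fun _ => 1) (fun _ => 0) j := by
  cases j with
  | inl i₀ =>
    have : ∀ i, ((α + Pi.single (.inl i₀) 1 : ι ⊕ κ → ℤ) (.inl i)).toNat =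
        (α (.inl i)).toNat + if i = i₀ then 1 else 0 := fun i => by
      have := hα i
      simp [Pi.single_apply]; split_ifs <;> omega
    rw [Finset.sum_congr rfl fun i _ => this i]
    simp [Finset.sum_add_distrib]
  | inr l => simp

lemma isLorentzFun_slackFun {ε : ℝ} (hε : 0 < ε) :
    IsLorentzFun (slackFun ε : (ι ⊕ κ → ℤ) → ℝ) := by
  classical
  refine ⟨fun α hα => ?_, fun α hα => by simp [slackFun, hα], fun α hα => ?_⟩
  · rw [slackFun, if_pos hα]; positivity
  set b : ℝ := if (∀ l, α (.inr l) ≤ 0) ∧ ∑ v, α v = -2 then ε ^ (∑ i, (α (.inl i)).toNat) else 0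
    with hb
  set u : ι ⊕ κ → ℝ := Sum.elim (fun _ => ε) (fun l => if α (.inr l) ≤ -1 then 1 else 0) with hu
  have hb0 : 0 ≤ b := by rw [hb]; split_ifs <;> positivity
  have hu0 : ∀ j, 0 ≤ u j := by
    rintro (i | l)
    · exact hε.le
    · simp only [hu, Sum.elim_inr]; split_ifs <;> norm_num
  have hexp : ∀ j k, ∑ i, ((α + Pi.single j 1 + Pi.single k 1 : ι ⊕ κ → ℤ) (.inl i)).toNat =
      ∑ i, (α (.inl i)).toNat + Sum.elim (fun _ => 1) (fun _ => 0) j +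
        Sum.elim (fun _ => 1) (fun _ => 0) k := by
    intro j k
    rw [sum_toNat_add_single, sum_toNat_add_single hα]
    intro i
    have := hα i
    simp [Pi.single_apply]; split_ifs <;> omega
  have hsum : ∀ j k, ∑ v, (α + Pi.single j 1 + Pi.single k 1 : ι ⊕ κ → ℤ) v = ∑ v, α v + 2 := by
    intro j k
    simp [Finset.sum_add_distrib]; ring
  have hfeas : ∀ j k, Feasible (α + Pi.single j 1 + Pi.single k 1) →
      slackFun ε (α + Pi.single j 1 + Pi.single k 1) = b * u j * u k := by
    intro j k h
    have hs : ∑ v, α v = -2 := by have := h.2.2; rw [hsum] at this; omega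
    have hc : ∀ l, α (.inr l) ≤ 0 := fun l => by
      have := h.2.1 l
      simp [Pi.single_apply] at this
      split_ifs at this <;> omega
    have hcol : ∀ l, j = .inr l ∨ k = .inr l → α (.inr l) ≤ -1 := fun l hl => by
      have := h.2.1 l
      simp [Pi.single_apply] at this
      rcases hl with hl | hl <;> simp only [hl, if_true] at this <;> split_ifs at this <;> omega
    rw [slackFun, if_pos h, hexp, hb, if_pos ⟨hc, hs⟩, pow_add, pow_add]
    rcases j with j | j <;> rcases k with k | k <;> simp [hu, hcol]
  have hle : ∀ j, slackFun ε (α + Pi.single j 1 + Pi.single j 1) ≤ b * u j * u j := by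
    intro j
    by_cases h : Feasible (α + Pi.single j 1 + Pi.single j 1)
    · exact (hfeas j j h).le
    · rw [slackFun, if_neg h]
      exact mul_nonneg (mul_nonneg hb0 (hu0 j)) (hu0 j)
  have heq : ∀ j k, j ≠ k → slackFun ε (α + Pi.single j 1 + Pi.single k 1) = b * u j * u k := by
    intro j k hjk
    by_cases h : Feasible (α + Pi.single j 1 + Pi.single k 1)
    · exact hfeas j k h
    rw [slackFun, if_neg h]
    by_contra! hne
    obtain ⟨h1, h2⟩ := mul_ne_zero_iff.mp hne.symm
    obtain ⟨h3, h4⟩ := mul_ne_zero_iff.mp h1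
    have hcs : (∀ l, α (.inr l) ≤ 0) ∧ ∑ v, α v = -2 := by
      by_contra hn; exact h3 (by rw [hb, if_neg hn])
    have hcol : ∀ l, u (.inr l) ≠ 0 → α (.inr l) ≤ -1 := fun l hl => by
      by_contra hn; exact hl (by simp [hu, hn])
    refine h ⟨fun i => ?_, fun l => ?_, by rw [hsum, hcs.2]; norm_num⟩
    · have := hα i
      simp [Pi.single_apply]; split_ifs <;> omega
    · have h5 := hcs.1 l
      by_cases hj : j = .inr l
      · have := hcol l (hj ▸ h4)
        have hk : Sum.inr l ≠ k := hj ▸ hjk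
        simp [hj, hk]; omega
      · by_cases hk : k = .inr l
        · have := hcol l (hk ▸ h2)
          simp [hk, Ne.symm hj]; omega
        · simp [Ne.symm hj, Ne.symm hk, h5]
  refine IsLorentz.of_hyperplane (hess_symm _ α)
    (Fintype.linearCombination ℝ u) fun w hw => ?_
  simp only [Fintype.linearCombination_apply, smul_eq_mul] at hw
  rw [hess_apply]
  calc ∑ j, ∑ k, w j * slackFun ε (α + Pi.single j 1 + Pi.single k 1) * w k
      ≤ ∑ j, ∑ k, b * ((w j * u j) * (w k * u k)) := by
        refine Finset.sum_le_sum fun j _ => Finset.sum_le_sum fun k _ => ?_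
        by_cases hjk : j = k
        · subst hjk
          nlinarith [mul_le_mul_of_nonneg_left (hle j) (sq_nonneg (w j))]
        · rw [heq j k hjk]; exact le_of_eq (by ring)
    _ = 0 := by
        simp [← Finset.mul_sum, hw]

variable {E : Type*} [Fintype E] [DecidableEq E]

/-- The slack function pushed along a list of arcs with weights `y`: a generating function of
transportation tables. -/
noncomputable def netFun (s : E → ι) (d : E → κ) (y : E → ℝ) (ε : ℝ) (L : List E) :
    (ι ⊕ κ → ℤ) → ℝ :=
  L.foldr (fun e F => pushArc (s e) (d e) (y e) F) (slackFun ε)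

omit [Fintype E] [DecidableEq E] in
lemma isLorentzFun_netFun (s : E → ι) (d : E → κ) {y : E → ℝ} (hy : ∀ e, 0 < y e) {ε : ℝ}
    (hε : 0 < ε) (L : List E) : IsLorentzFun (netFun s d y ε L) := by
  induction L with
  | nil => exact isLorentzFun_slackFun hε
  | cons e L ih => exact ih.pushArc _ _ (hy e)

omit [Fintype E] [DecidableEq E] in
lemma netFun_eq_zero (s : E → ι) (d : E → κ) (y : E → ℝ) (ε : ℝ) (L : List E) {α : ι ⊕ κ → ℤ}
    (hα : ¬ Feasible α) : netFun s d y ε L α = 0 := by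
  induction L generalizing α with
  | nil => simp [netFun, slackFun, hα]
  | cons e L ih =>
    rw [netFun, List.foldr_cons, pushArc]
    refine Finset.sum_eq_zero fun k _ => ?_
    rw [mul_eq_zero]
    exact .inr (ih fun h => hα h.of_sub_arc)

lemma netFun_eq_sum (s : E → ι) (d : E → κ) (y : E → ℝ) (ε : ℝ) (K : ℕ) {L : List E}
    (hL : L.Nodup) {α : ι ⊕ κ → ℤ} (hα : ∀ i, α (.inl i) ≤ K) :
    netFun s d y ε L α =
      ∑ X ∈ Fintype.piFinset (fun e => if e ∈ L then Finset.range (K + 1) else {0}),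
        (∏ e, y e ^ X e) * slackFun ε (α - ∑ e, X e • arc (s e) (d e)) := by
  induction L generalizing α with
  | nil =>
    simp only [netFun, List.foldr_nil, List.not_mem_nil, if_false, Fintype.piFinset_singleton]
    simp
  | cons e L ih =>
    obtain ⟨heL, hL⟩ := List.nodup_cons.mp hL
    have h1 : netFun s d y ε (e :: L) α = ∑ k ∈ Finset.range (K + 1),
        y e ^ k * netFun s d y ε L (α - k • arc (s e) (d e)) := by
      refine Finset.sum_subset (Finset.range_subset_range.mpr ?_) fun k _ hk => ?_
      · have := hα (s e); omega
      · rw [mul_eq_zero]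
        refine .inr (netFun_eq_zero s d y ε L fun h => ?_)
        have := h.1 (s e)
        simp at this hk
        omega
    rw [h1]
    have h2 : ∀ k : ℕ, ∀ i, (α - k • arc (s e) (d e) : ι ⊕ κ → ℤ) (.inl i) ≤ K := fun k i => by
      have := hα i
      simp; split_ifs <;> omega
    simp_rw [ih hL (h2 _), Finset.mul_sum]
    rw [← Finset.sum_product']
    refine Finset.sum_bij' (fun p _ => p.2 + Pi.single e p.1)
      (fun X _ => (X e, Function.update X e 0)) ?_ ?_ ?_ ?_ ?_
    · rintro ⟨k, X⟩ h
      simp only [Finset.mem_product, Finset.mem_range, Fintype.mem_piFinset] at h ⊢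
      intro e'
      have h3 := h.2 e'
      by_cases he : e' = e
      · subst he
        simp only [heL, if_false, Finset.mem_singleton] at h3
        simp [h3, h.1]
      · simpa [he] using h3
    · intro X h
      simp only [Finset.mem_product, Finset.mem_range, Fintype.mem_piFinset] at h ⊢
      refine ⟨by simpa using h e, fun e' => ?_⟩
      by_cases he : e' = e
      · subst he
        simp [heL]
      · simpa [he] using h e'
    · rintro ⟨k, X⟩ h
      simp only [Finset.mem_product, Fintype.mem_piFinset] at h
      have h3 : X e = 0 := by simpa [heL] using h.2 e
      ext e'
      · simp [h3]
      · by_cases he : e' = e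
        · subst he; simp [h3]
        · simp [he]
    · intro X h
      ext e'
      by_cases he : e' = e
      · subst he; simp
      · simp [he]
    · rintro ⟨k, X⟩ h
      simp only [Pi.add_apply, pow_add, Finset.prod_mul_distrib, add_smul, Finset.sum_add_distrib]
      have h3 : ∏ e', y e' ^ (Pi.single e k : E → ℕ) e' = y e ^ k := by
        rw [Finset.prod_eq_single e] <;> simp +contextual
      have h4 : ∑ e', (Pi.single e k : E → ℕ) e' • arc (s e') (d e') = k • arc (s e) (d e) := by
        rw [Finset.sum_eq_single e] <;> simp +contextual
      rw [h3, h4, ← sub_sub, sub_right_comm]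
      ring

lemma IsLorentzFun.mul_le_sq {F : (ι ⊕ κ → ℤ) → ℝ} (hF : IsLorentzFun F) {α : ι ⊕ κ → ℤ}
    (hα : ∀ i, 0 ≤ α (.inl i)) (j k : ι ⊕ κ) :
    F (α + Pi.single j 1 + Pi.single j 1) * F (α + Pi.single k 1 + Pi.single k 1) ≤
      F (α + Pi.single j 1 + Pi.single k 1) ^ 2 := by
  rcases (hF.nonneg (α + Pi.single j 1 + Pi.single j 1)).eq_or_lt with h | h
  · rw [← h, zero_mul]; positivity
  · simpa only [hess_single] using hF.lorentz α hα (Pi.single j 1) (Pi.single k 1)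
      (by rwa [hess_single])

omit [DecidableEq ι] [DecidableEq κ] in
lemma slackFun_zero (α : ι ⊕ κ → ℤ) : slackFun 0 α = if α = 0 then 1 else 0 := by
  by_cases h0 : α = 0
  · subst h0; simp [slackFun, Feasible]
  rw [if_neg h0, slackFun]
  split_ifs with h
  · refine zero_pow fun hs => h0 ?_
    obtain ⟨h1, h2, h3⟩ := h
    have h4 : ∀ i, α (.inl i) = 0 := fun i => by
      have := (Finset.sum_eq_zero_iff.mp hs) i (Finset.mem_univ i)
      have := h1 i
      omega
    rw [Fintype.sum_sum_type] at h3
    simp only [h4, Finset.sum_const_zero, zero_add] at h3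
    have h5 := (Finset.sum_eq_zero_iff_of_nonpos fun l _ => h2 l).mp h3
    ext (i | l)
    · exact h4 i
    · exact h5 l (Finset.mem_univ l)
  · rfl

lemma netFun_univ (s : E → ι) (d : E → κ) (y : E → ℝ) (ε : ℝ) (K : ℕ) {α : ι ⊕ κ → ℤ}
    (hα : ∀ i, α (.inl i) ≤ K) :
    netFun s d y ε Finset.univ.toList α =
      ∑ X ∈ Fintype.piFinset (fun _ : E => Finset.range (K + 1)),
        (∏ e, y e ^ X e) * slackFun ε (α - ∑ e, X e • arc (s e) (d e)) := by
  rw [netFun_eq_sum s d y ε K (Finset.nodup_toList _) hα]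
  simp

lemma netFun_univ_zero (s : E → ι) (d : E → κ) (y : E → ℝ) (K : ℕ) {α : ι ⊕ κ → ℤ}
    (hα : ∀ i, α (.inl i) ≤ K) :
    netFun s d y 0 Finset.univ.toList α =
      ∑ X ∈ Fintype.piFinset (fun _ : E => Finset.range (K + 1)) with
        α = ∑ e, X e • arc (s e) (d e), ∏ e, y e ^ X e := by
  rw [netFun_univ s d y 0 K hα, Finset.sum_filter]
  refine Finset.sum_congr rfl fun X _ => ?_
  simp [slackFun_zero, sub_eq_zero]

omit [Fintype κ] [DecidableEq ι] [DecidableEq κ] in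
lemma exists_nat_row_le (α : ι ⊕ κ → ℤ) : ∃ K : ℕ, ∀ i, α (.inl i) ≤ K :=
  ⟨∑ i, (α (.inl i)).toNat, fun i => by
    have := Finset.single_le_sum (f := fun i => (α (.inl i)).toNat) (fun _ _ => Nat.zero_le _)
      (Finset.mem_univ i)
    omega⟩

lemma continuous_netFun (s : E → ι) (d : E → κ) (y : E → ℝ) (α : ι ⊕ κ → ℤ) :
    Continuous fun ε => netFun s d y ε Finset.univ.toList α := by
  obtain ⟨K, hK⟩ := exists_nat_row_le α
  simp_rw [netFun_univ s d y _ K hK]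
  refine continuous_finsetSum _ fun X _ => continuous_const.mul ?_
  simp only [slackFun]
  split_ifs <;> fun_prop

lemma netFun_zero_le (s : E → ι) (d : E → κ) {y : E → ℝ} (hy : ∀ e, 0 < y e) {ε : ℝ}
    (hε : 0 < ε) (α : ι ⊕ κ → ℤ) :
    netFun s d y 0 Finset.univ.toList α ≤ netFun s d y ε Finset.univ.toList α := by
  obtain ⟨K, hK⟩ := exists_nat_row_le α
  rw [netFun_univ s d y _ K hK, netFun_univ s d y _ K hK]
  refine Finset.sum_le_sum fun X _ => mul_le_mul_of_nonneg_left ?_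
    (Finset.prod_nonneg fun e _ => pow_nonneg (hy e).le _)
  simp only [slackFun]
  split_ifs
  · exact pow_le_pow_left₀ le_rfl hε.le _
  · rfl

lemma le_netFun_zero (s : E → ι) (d : E → κ) (y : E → ℝ) {α : ι ⊕ κ → ℤ} {a b : ℝ}
    (h : ∀ ε > 0, a ≤ b * netFun s d y ε Finset.univ.toList α) :
    a ≤ b * netFun s d y 0 Finset.univ.toList α := by
  refine ge_of_tendsto (((continuous_netFun s d y α).const_mul b).tendsto 0 |>.mono_left
    (nhdsWithin_le_nhds (s := Set.Ioi 0))) ?_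
  filter_upwards [self_mem_nhdsWithin] with ε hε using h ε hε

lemma netFun_zero_mul_le_sq (s : E → ι) (d : E → κ) {y : E → ℝ} (hy : ∀ e, 0 < y e)
    {α : ι ⊕ κ → ℤ} (hα : ∀ i, 0 ≤ α (.inl i)) (j k : ι ⊕ κ) :
    netFun s d y 0 Finset.univ.toList (α + Pi.single j 1 + Pi.single j 1) *
      netFun s d y 0 Finset.univ.toList (α + Pi.single k 1 + Pi.single k 1) ≤
      netFun s d y 0 Finset.univ.toList (α + Pi.single j 1 + Pi.single k 1) ^ 2 := by
  have hc := continuous_netFun s d y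
  refine le_of_tendsto_of_tendsto ((((hc _).mul (hc _)).tendsto 0).mono_left
    (nhdsWithin_le_nhds (s := Set.Ioi 0))) ((((hc _).pow 2).tendsto 0).mono_left
    nhdsWithin_le_nhds) ?_
  filter_upwards [self_mem_nhdsWithin] with ε hε
  exact (isLorentzFun_netFun s d hy hε _).mul_le_sq hα j k

end Network

/-- A positive log-concave sequence, reweighted geometrically, has its maximum at any prescribed
index `c + 1`. -/
lemma exists_pow_mul_le_of_logConcave {a : ℕ → ℝ} {c : ℕ} (h0 : ∀ k, 0 ≤ a k)
    (hlc : ∀ k, a k * a (k + 2) ≤ a (k + 1) ^ 2) (hpos : ∀ k ≤ c + 1, 0 < a k)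
    (hz : ∀ k, a k = 0 → a (k + 1) = 0) :
    ∃ t > 0, ∀ k, a k * t ^ k ≤ a (c + 1) * t ^ (c + 1) := by
  have hc := hpos c (by omega)
  have hc1 := hpos (c + 1) le_rfl
  set t := a c / a (c + 1) with ht
  have ht0 : 0 < t := by positivity
  have hct : a (c + 1) * t = a c := by rw [ht]; field_simp
  have hup : ∀ k, a (c + k + 1) * t ≤ a (c + k) := by
    intro k
    induction k with
    | zero => exact hct.le
    | succ k ih =>
      rcases (h0 (c + (k + 1))).eq_or_lt with h | h
      · rw [hz _ h.symm, zero_mul, ← h]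
      · have h1 := hlc (c + k)
        have h2 := mul_le_mul_of_nonneg_right ih (h0 (c + k + 2))
        rw [show c + (k + 1) = c + k + 1 by ring] at h ⊢
        rw [show c + k + 1 + 1 = c + k + 2 by ring]
        refine le_of_mul_le_mul_left ?_ h
        linarith
  have hdown : ∀ k ≤ c, a (c - k) ≤ a (c - k + 1) * t := by
    intro k
    induction k with
    | zero => exact fun _ => hct.ge
    | succ k ih =>
      intro hk
      obtain ⟨q, rfl⟩ : ∃ q, c = k + 1 + q := ⟨c - (k + 1), by omega⟩
      have ih := ih (by omega)
      rw [show k + 1 + q - k = q + 1 by omega] at ih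
      rw [show k + 1 + q - (k + 1) = q by omega]
      have h1 := hlc q
      have h2 := hpos (q + 2) (by omega)
      have h3 := mul_le_mul_of_nonneg_left ih (h0 (q + 1))
      rw [show q + 1 + 1 = q + 2 by ring] at h3
      refine le_of_mul_le_mul_right ?_ h2
      linarith
  refine ⟨t, ht0, fun k => ?_⟩
  rcases le_or_gt k (c + 1) with hk | hk
  · refine Nat.decreasingInduction' (P := fun k => a k * t ^ k ≤ a (c + 1) * t ^ (c + 1))
      (fun q hq _ ih => le_trans ?_ ih) hk le_rfl
    have h := hdown (c - q) (by omega)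
    rw [show c - (c - q) = q by omega] at h
    rw [pow_succ' t q, ← mul_assoc]
    exact mul_le_mul_of_nonneg_right h (by positivity)
  · refine Nat.le_induction (P := fun k _ => a k * t ^ k ≤ a (c + 1) * t ^ (c + 1)) le_rfl
      (fun q hq ih => le_trans ?_ ih) k hk.le
    have h := hup (q - c)
    rw [show c + (q - c) = q by omega] at h
    rw [pow_succ' t q, ← mul_assoc]
    exact mul_le_mul_of_nonneg_right h (by positivity)

section Tables

variable {I J : Type*} [Fintype I] [Fintype J] [DecidableEq I] [DecidableEq J]

/-- Tables with row sums `r` and column sums `c l` for `l ∈ S`; entries are bounded by `K` only to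
make the set finite. -/
def tables (K : ℕ) (r : I → ℕ) (c : J → ℕ) (S : Finset J) : Finset (I × J → ℕ) :=
  {X ∈ Fintype.piFinset (fun _ => Finset.range (K + 1)) |
    (∀ i, ∑ l, X (i, l) = r i) ∧ ∀ l ∈ S, ∑ i, X (i, l) = c l}

/-- Weight `1` on the columns in `S`, and `y` elsewhere. -/
def freeWeight (S : Finset J) (y : J → ℝ) (l : J) : ℝ := if l ∈ S then 1 else y l

/-- Generating function, in the columns outside `S`, of the tables in `tables K r c S`. -/
noncomputable def tableSum (K : ℕ) (r : I → ℕ) (c : J → ℕ) (S : Finset J) (y : J → ℝ) : ℝ :=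
  ∑ X ∈ tables K r c S, ∏ e, freeWeight S y e.2 ^ X e

/-- Column of an arc after merging all columns outside `T` into a sink. -/
def mergeCol (T : Finset J) (e : I × J) : Option J := if e.2 ∈ T then some e.2 else none

/-- Prescribed margins with `k` in column `j` and the rest in the sink. -/
def margins (r : I → ℕ) (c : J → ℕ) (S : Finset J) (j : J) (k : ℕ) : I ⊕ Option J → ℤ :=
  Sum.elim (fun i => r i) fun o => o.elim (k - (∑ i, (r i : ℤ) - ∑ l ∈ S, (c l : ℤ)))
    fun l => if l ∈ S then -(c l : ℤ) else if l = j then -(k : ℤ) else 0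

variable {K : ℕ} {r : I → ℕ} {c : J → ℕ} {S : Finset J} {j : J} {y : J → ℝ}

omit [Fintype J] in
lemma freeWeight_pos (hy : ∀ l, 0 < y l) (l : J) : 0 < freeWeight S y l := by
  unfold freeWeight; split_ifs
  · exact one_pos
  · exact hy l

lemma sum_arc_mergeCol_inl (T : Finset J) (X : I × J → ℕ) (i : I) :
    (∑ e, X e • arc e.1 (mergeCol T e) : I ⊕ Option J → ℤ) (.inl i) = ∑ l, (X (i, l) : ℤ) := by
  simp [Finset.sum_apply, Fintype.sum_prod_type, Finset.sum_comm (s := (Finset.univ : Finset I))]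

lemma sum_arc_mergeCol_some (T : Finset J) (X : I × J → ℕ) (l : J) :
    (∑ e, X e • arc e.1 (mergeCol T e) : I ⊕ Option J → ℤ) (.inr (some l)) =
      if l ∈ T then -∑ i, (X (i, l) : ℤ) else 0 := by
  have : ∀ i l', (X (i, l') : ℤ) * (if some l = mergeCol T (i, l') then (-1 : ℤ) else 0) =
      if l = l' then (if l ∈ T then -(X (i, l) : ℤ) else 0) else 0 := by
    intro i l'
    by_cases h : l = l'
    · subst h; by_cases h' : l ∈ T <;> simp [mergeCol, h']
    · by_cases h' : l' ∈ T <;> simp [mergeCol, h', h]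
  simp [Finset.sum_apply, Fintype.sum_prod_type, this]

omit [DecidableEq I] in
lemma sum_margins (hj : j ∉ S) (k : ℕ) : ∑ v, margins r c S j k v = 0 := by
  have : ∀ l, (if l ∈ S then -(c l : ℤ) else if l = j then -(k : ℤ) else 0) =
      (if l ∈ S then -(c l : ℤ) else 0) + if l = j then -(k : ℤ) else 0 := by
    intro l
    by_cases h : l ∈ S
    · have : l ≠ j := fun h' => hj (h' ▸ h)
      simp [h, this]
    · simp [h]
  simp [margins, Fintype.sum_sum_type, Fintype.sum_option, this, Finset.sum_add_distrib]
  ring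

lemma margins_eq_iff (hj : j ∉ S) (k : ℕ) (X : I × J → ℕ) :
    margins r c S j k = ∑ e, X e • arc e.1 (mergeCol (insert j S) e) ↔
      ((∀ i, ∑ l, X (i, l) = r i) ∧ ∀ l ∈ S, ∑ i, X (i, l) = c l) ∧ ∑ i, X (i, j) = k := by
  have hjS : ∀ l ∈ S, l ≠ j := fun l h h' => hj (h' ▸ h)
  constructor
  · intro h
    refine ⟨⟨fun i => ?_, fun l hl => ?_⟩, ?_⟩
    · have := congrFun h (.inl i)
      rw [sum_arc_mergeCol_inl] at this
      simp only [margins, Sum.elim_inl] at this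
      exact_mod_cast this.symm
    · have := congrFun h (.inr (some l))
      rw [sum_arc_mergeCol_some] at this
      simp [margins, hl] at this
      exact_mod_cast this.symm
    · have := congrFun h (.inr (some j))
      rw [sum_arc_mergeCol_some] at this
      simp [margins, hj] at this
      exact_mod_cast this.symm
  · rintro ⟨⟨h1, h2⟩, h3⟩
    set β := ∑ e, X e • arc e.1 (mergeCol (insert j S) e) with hβ
    have hl : ∀ i, margins r c S j k (.inl i) = β (.inl i) := fun i => by
      rw [hβ, sum_arc_mergeCol_inl]
      simp only [margins, Sum.elim_inl]
      exact_mod_cast (h1 i).symm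
    have hs : ∀ l, margins r c S j k (.inr (some l)) = β (.inr (some l)) := fun l => by
      rw [hβ, sum_arc_mergeCol_some]
      by_cases hlS : l ∈ S
      · simp [margins, hlS, ← h2 l hlS]
      · by_cases hlj : l = j
        · subst hlj; simp [margins, hj, ← h3]
        · simp [margins, hlS, hlj]
    have hn : margins r c S j k (.inr none) = β (.inr none) := by
      have e1 := sum_margins (r := r) (c := c) hj k
      have e2 : ∑ v, β v = 0 := by
        simp only [hβ, Finset.sum_apply, Pi.smul_apply]
        rw [Finset.sum_comm]
        exact Finset.sum_eq_zero fun e _ => by rw [← Finset.smul_sum, sum_arc, smul_zero]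
      rw [Fintype.sum_sum_type, Fintype.sum_option] at e1 e2
      simp only [hl, hs] at e1
      linarith
    ext (i | _ | l)
    · exact hl i
    · exact hn
    · exact hs l

lemma netFun_margins (hK : ∀ i, r i ≤ K) (hj : j ∉ S) (k : ℕ) :
    netFun Prod.fst (mergeCol (insert j S)) (fun e => freeWeight (insert j S) y e.2) 0
      Finset.univ.toList (margins r c S j k) =
      ∑ X ∈ tables K r c S with ∑ i, X (i, j) = k, ∏ e, freeWeight (insert j S) y e.2 ^ X e := by
  rw [netFun_univ_zero _ _ _ K (fun i => by simpa [margins] using hK i)]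
  simp only [margins_eq_iff hj, tables, Finset.filter_filter]

lemma tableSum_update (hj : j ∉ S) (t : ℝ) :
    tableSum K r c S (Function.update y j t) = ∑ k ∈ Finset.range (∑ i, r i + 1),
      (∑ X ∈ tables K r c S with ∑ i, X (i, j) = k,
        ∏ e, freeWeight (insert j S) y e.2 ^ X e) * t ^ k := by
  have hw : ∀ X : I × J → ℕ, ∏ e, freeWeight S (Function.update y j t) e.2 ^ X e =
      (∏ e, freeWeight (insert j S) y e.2 ^ X e) * t ^ (∑ i, X (i, j)) := by
    intro X
    have : ∀ e : I × J, freeWeight S (Function.update y j t) e.2 ^ X e =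
        freeWeight (insert j S) y e.2 ^ X e * if e.2 = j then t ^ X e else 1 := by
      rintro ⟨i, l⟩
      by_cases h : l = j
      · subst h; simp [freeWeight, hj]
      · simp [freeWeight, h]
    rw [Finset.prod_congr rfl fun e _ => this e, Finset.prod_mul_distrib]
    congr 1
    rw [Fintype.prod_prod_type, ← Finset.prod_pow_eq_pow_sum]
    simp
  have hmaps : ∀ X ∈ tables K r c S, ∑ i, X (i, j) ∈ Finset.range (∑ i, r i + 1) := by
    intro X hX
    simp only [tables, Finset.mem_filter] at hX
    rw [Finset.mem_range, Nat.lt_succ_iff]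
    refine Finset.sum_le_sum fun i _ => ?_
    rw [← hX.2.1 i]
    exact Finset.single_le_sum (f := fun l => X (i, l)) (fun _ _ => Nat.zero_le _)
      (Finset.mem_univ j)
  rw [tableSum, ← Finset.sum_fiberwise_of_maps_to hmaps]
  refine Finset.sum_congr rfl fun k _ => ?_
  rw [Finset.sum_mul]
  refine Finset.sum_congr rfl fun X hX => ?_
  rw [hw, (Finset.mem_filter.mp hX).2]

lemma tableSum_insert :
    tableSum K r c (insert j S) y = ∑ X ∈ tables K r c S with ∑ i, X (i, j) = c j,
        ∏ e, freeWeight (insert j S) y e.2 ^ X e := by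
  rw [tableSum]
  refine Finset.sum_congr ?_ fun _ _ => rfl
  ext X
  simp only [tables, Finset.mem_filter, Finset.forall_mem_insert]
  tauto

/-- Fixing one more column costs at most a factor `∑ i, r i + 1`. -/
lemma le_tableSum_insert (hK : ∀ i, r i ≤ K) (hj : j ∉ S) (hcj : 0 < c j)
    (hsum : ∑ l ∈ insert j S, c l ≤ ∑ i, r i) (hy : ∀ l, 0 < y l) {δ : ℝ}
    (h : ∀ t > 0, δ * t ^ c j ≤ tableSum K r c S (Function.update y j t)) :
    δ ≤ (∑ i, (r i : ℝ) + 1) * tableSum K r c (insert j S) y := by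
  rw [tableSum_insert, ← netFun_margins hK hj]
  refine le_netFun_zero _ _ _ fun ε hε => ?_
  set w : I × J → ℝ := fun e => freeWeight (insert j S) y e.2 with hw_def
  have hw : ∀ e, 0 < w e := fun e => freeWeight_pos hy e.2
  set F := netFun Prod.fst (mergeCol (insert j S)) w ε Finset.univ.toList with hFdef
  have hF : IsLorentzFun F := isLorentzFun_netFun _ _ hw hε _
  have hsum' : ∑ l ∈ S, (c l : ℤ) + c j ≤ ∑ i, (r i : ℤ) := by
    rw [Finset.sum_insert hj] at hsum
    exact_mod_cast (add_comm _ _).trans_le hsum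
  have hfeas : ∀ k : ℕ, Feasible (margins r c S j k) ↔
      (k : ℤ) ≤ ∑ i, (r i : ℤ) - ∑ l ∈ S, (c l : ℤ) := by
    intro k
    constructor
    · intro h
      have := h.2.1 none
      simp [margins] at this
      linarith
    · intro hk
      refine ⟨fun i => by simp [margins], ?_, sum_margins hj k⟩
      rintro (_ | l)
      · simp [margins]; linarith
      · simp only [margins, Sum.elim_inr, Option.elim_some]
        split_ifs <;> simp
  obtain ⟨b, hb⟩ : ∃ b, c j = b + 1 := ⟨c j - 1, by omega⟩
  obtain ⟨t, ht, hmax⟩ := exists_pow_mul_le_of_logConcave (a := fun k => F (margins r c S j k))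
    (c := b) (fun k => hF.nonneg _) (fun k => by
      set A := margins r c S j (k + 1) - Pi.single (.inr (some j)) 1 - Pi.single (.inr none) 1
        with hA
      have hlog := hF.mul_le_sq (α := A) (fun i => by simp [hA, margins])
        (.inr (some j)) (.inr none)
      have e0 : A + Pi.single (.inr (some j)) 1 + Pi.single (.inr none) 1 =
          margins r c S j (k + 1) := by rw [hA]; abel
      have e1 : A + Pi.single (.inr (some j)) 1 + Pi.single (.inr (some j)) 1 =
          margins r c S j k := by
        ext (i | _ | l)
        · simp [hA, margins]
        · simp [hA, margins]; ring
        · by_cases hl : l = j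
          · subst hl; simp [hA, margins, hj]
          · simp [hA, margins, hl]
      have e2 : A + Pi.single (.inr none) 1 + Pi.single (.inr none) 1 =
          margins r c S j (k + 2) := by
        ext (i | _ | l)
        · simp [hA, margins]
        · simp [hA, margins]; ring
        · by_cases hl : l = j
          · subst hl; simp [hA, margins, hj]; ring
          · simp [hA, margins, hl]
      rwa [e0, e1, e2] at hlog)
    (fun k hk => hF.pos _ ((hfeas k).mpr (by have : (k : ℤ) ≤ c j := by omega
                                             linarith)))
    (fun k hk => hF.zero _ fun h' => by
      have h1 := (hfeas (k + 1)).mp h'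
      push_cast at h1
      exact (hF.pos _ ((hfeas k).mpr (by linarith))).ne' hk)
  rw [← hb] at hmax
  refine le_of_mul_le_mul_right ?_ (pow_pos ht (c j))
  calc δ * t ^ c j ≤ _ := h t ht
    _ ≤ ∑ k ∈ Finset.range (∑ i, r i + 1), F (margins r c S j k) * t ^ k := by
        rw [tableSum_update hj]
        refine Finset.sum_le_sum fun k _ => mul_le_mul_of_nonneg_right ?_ (by positivity)
        rw [← netFun_margins hK hj]
        exact netFun_zero_le _ _ hw hε _
    _ ≤ ∑ k ∈ Finset.range (∑ i, r i + 1), F (margins r c S j (c j)) * t ^ c j :=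
        Finset.sum_le_sum fun k _ => hmax k
    _ = _ := by
        rw [Finset.sum_const, Finset.card_range, nsmul_eq_mul]
        push_cast; ring

lemma le_tableSum (hK : ∀ i, r i ≤ K) (hc : ∀ l, 0 < c l) (hsum : ∑ l, c l = ∑ i, r i) {δ : ℝ}
    (h : ∀ y : J → ℝ, (∀ l, 0 < y l) → δ * ∏ l, y l ^ c l ≤ tableSum K r c ∅ y)
    (S : Finset J) (hy : ∀ l, 0 < y l) :
    δ * ∏ l, freeWeight S y l ^ c l ≤ (∑ i, (r i : ℝ) + 1) ^ S.card * tableSum K r c S y := by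
  induction S using Finset.induction_on generalizing y with
  | empty => simpa [freeWeight] using h y hy
  | insert j S hj ih =>
    have hN : 0 < ∑ i, (r i : ℝ) + 1 := by positivity
    rw [Finset.card_insert_of_notMem hj, pow_succ, mul_assoc, ← div_le_iff₀' (by positivity)]
    refine le_tableSum_insert hK hj (hc j)
      ((Finset.sum_le_sum_of_subset (Finset.subset_univ _)).trans hsum.le) hy fun t ht => ?_
    rw [div_mul_eq_mul_div, div_le_iff₀' (by positivity)]
    refine le_trans (le_of_eq ?_) (ih (y := Function.update y j t) fun l => ?_)
    · rw [mul_assoc]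
      congr 1
      have : ∀ l, freeWeight S (Function.update y j t) l ^ c l =
          freeWeight (insert j S) y l ^ c l * if l = j then t ^ c l else 1 := by
        intro l
        by_cases h : l = j
        · subst h; simp [freeWeight, hj]
        · simp [freeWeight, h]
      rw [Finset.prod_congr rfl fun l _ => this l, Finset.prod_mul_distrib]
      simp
    · by_cases hl : l = j
      · subst hl; simpa using ht
      · simpa [hl] using hy l

end Tables

section Rows

variable {J : Type*} [Fintype J] [DecidableEq J] {y : J → ℝ}

/-- The complete homogeneous symmetric polynomial of degree `k`, evaluated at `y`. -/
noncomputable def completeSum (y : J → ℝ) (k : ℕ) : ℝ :=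
  ∑ p ∈ Finset.piAntidiag Finset.univ k, ∏ l, y l ^ p l

lemma netFun_eq_completeSum (y : J → ℝ) (k : ℕ) :
    netFun (fun _ : J => ()) (fun _ : J => ()) y 0 Finset.univ.toList
      (Sum.elim (fun _ => (k : ℤ)) fun _ => -(k : ℤ)) = completeSum y k := by
  rw [netFun_univ_zero _ _ _ k (fun i => by simp), completeSum]
  refine Finset.sum_congr ?_ fun _ _ => rfl
  ext X
  simp only [Finset.mem_filter, Fintype.mem_piFinset, Finset.mem_range, Finset.mem_piAntidiag,
    Finset.mem_univ, implies_true, and_true]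
  constructor
  · rintro ⟨-, h⟩
    have := congrFun h (.inl ())
    simp [Finset.sum_apply] at this
    exact_mod_cast this.symm
  · intro h
    refine ⟨fun l => ?_, ?_⟩
    · have := Finset.single_le_sum (f := X) (fun _ _ => Nat.zero_le _) (Finset.mem_univ l)
      change _ ≤ Finset.univ.sum X at this
      rw [h] at this; omega
    · ext (i | i) <;> simp [Finset.sum_apply, ← h]

lemma completeSum_mul_le_sq (hy : ∀ l, 0 < y l) (k : ℕ) :
    completeSum y k * completeSum y (k + 2) ≤ completeSum y (k + 1) ^ 2 := by
  have h := netFun_zero_mul_le_sq (ι := Unit) (κ := Unit) (fun _ : J => ()) (fun _ : J => ()) hy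
    (α := Sum.elim (fun _ => (k : ℤ)) fun _ => -(k + 2 : ℤ)) (fun _ => by simp)
    (.inr ()) (.inl ())
  rw [← netFun_eq_completeSum, ← netFun_eq_completeSum, ← netFun_eq_completeSum]
  convert h using 3
  all_goals ext (i | i) <;> (simp; try ring)

lemma completeSum_pos [Nonempty J] (hy : ∀ l, 0 < y l) (k : ℕ) : 0 < completeSum y k := by
  obtain ⟨l⟩ := ‹Nonempty J›
  refine Finset.sum_pos (fun p _ => Finset.prod_pos fun l _ => pow_pos (hy l) _)
    ⟨Pi.single l k, ?_⟩
  simp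

lemma mul_completeSum_le (hy : ∀ l, 0 < y l) (l : J) (k : ℕ) :
    y l * completeSum y k ≤ completeSum y (k + 1) := by
  have hinj : Function.Injective fun p : J → ℕ => p + Pi.single l 1 :=
    add_left_injective _
  rw [completeSum, Finset.mul_sum]
  refine le_trans (le_of_eq ?_) (Finset.sum_le_sum_of_subset_of_nonneg
    (s := (Finset.piAntidiag Finset.univ k).map ⟨_, hinj⟩) ?_ fun p _ _ =>
      Finset.prod_nonneg fun l _ => pow_nonneg (hy l).le _)
  · rw [Finset.sum_map]
    refine Finset.sum_congr rfl fun p _ => ?_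
    simp only [Function.Embedding.coeFn_mk, Pi.add_apply, pow_add, Finset.prod_mul_distrib]
    rw [mul_comm, Finset.prod_eq_single (a := l) (f := fun l' => y l' ^ (Pi.single l 1 : J → ℕ) l')]
      <;> simp +contextual
  · intro p hp
    simp only [Finset.mem_map, Finset.mem_piAntidiag, Function.Embedding.coeFn_mk] at hp ⊢
    obtain ⟨q, hq, rfl⟩ := hp
    simp [Finset.sum_add_distrib, hq.1]

/-- A uniform bound for the partial sums of the generating function of `completeSum y` bounds the
product of geometric series. -/
lemma prod_inv_le_of_partialSum_le (hy : ∀ l, 0 < y l) {x B : ℝ} (hx : 0 < x)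
    (hxy : ∀ l, x * y l < 1) (hB : ∀ M, ∑ k ∈ Finset.range M, completeSum y k * x ^ k ≤ B) :
    ∏ l, (1 - x * y l)⁻¹ ≤ B := by
  have hlim : Filter.Tendsto (fun K : ℕ => ∏ l, ∑ k ∈ Finset.range K, (x * y l) ^ k)
      Filter.atTop (nhds (∏ l, (1 - x * y l)⁻¹)) :=
    tendsto_finsetProd _ fun l _ =>
      (hasSum_geometric_of_lt_one (mul_pos hx (hy l)).le (hxy l)).tendsto_sum_nat
  refine le_of_tendsto' hlim fun K => ?_
  refine le_trans ?_ (hB (Fintype.card J * K + 1))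
  rw [Finset.prod_univ_sum]
  have hmaps : ∀ p ∈ Fintype.piFinset (fun _ : J => Finset.range K),
      ∑ l, p l ∈ Finset.range (Fintype.card J * K + 1) := by
    intro p hp
    rw [Finset.mem_range, Nat.lt_succ_iff]
    refine (Finset.sum_le_card_nsmul _ _ K fun l _ => ?_).trans (by simp)
    have := Fintype.mem_piFinset.mp hp l
    simp at this; omega
  rw [← Finset.sum_fiberwise_of_maps_to hmaps]
  refine Finset.sum_le_sum fun k _ => ?_
  rw [completeSum, Finset.sum_mul]
  refine le_trans (le_of_eq ?_) (Finset.sum_le_sum_of_subset_of_nonneg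
    (s := {p ∈ Fintype.piFinset (fun _ : J => Finset.range K) | ∑ l, p l = k}) ?_
    fun p _ _ => mul_nonneg (Finset.prod_nonneg fun l _ => pow_nonneg (hy l).le _) (by positivity))
  · refine Finset.sum_congr rfl fun p hp => ?_
    rw [← (Finset.mem_filter.mp hp).2, ← Finset.prod_pow_eq_pow_sum, ← Finset.prod_mul_distrib]
    exact Finset.prod_congr rfl fun l _ => by rw [mul_pow, mul_comm]
  · intro p hp
    simp [(Finset.mem_filter.mp hp).2]

end Rows

/-- Partial sums of a positive log-concave sequence, reweighted slightly below the ratio at `r`. -/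
lemma sum_range_le_of_logConcave {h : ℕ → ℝ} (hpos : ∀ k, 0 < h k)
    (hlc : ∀ k, h k * h (k + 2) ≤ h (k + 1) ^ 2) {r : ℕ} (hr : 0 < r) {x : ℝ}
    (hx : x = (1 - 1 / (2 * r)) * (h r / h (r + 1))) (M : ℕ) :
    ∑ k ∈ Finset.range M, h k * x ^ k ≤ 4 * r * (h r * x ^ r) := by
  set θ : ℝ := 1 - 1 / (2 * r) with hθ
  have hr1 : (1 : ℝ) ≤ r := by exact_mod_cast hr
  have hθ2 : (1 : ℝ) / 2 ≤ θ := by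
    have : 1 / (2 * (r : ℝ)) ≤ 1 / 2 := one_div_le_one_div_of_le (by norm_num) (by linarith)
    linarith
  have hθ1 : θ < 1 := by
    have : 0 < 1 / (2 * (r : ℝ)) := by positivity
    linarith
  have hθ0 : 0 < θ := by linarith
  have hx0 : 0 < x := by rw [hx]; have := hpos r; have := hpos (r + 1); positivity
  have hratio : ∀ k, h k / h (k + 1) ≤ h (k + 1) / h (k + 2) := fun k => by
    rw [div_le_div_iff₀ (hpos _) (hpos _), ← sq]; exact hlc k
  have hmono : Monotone fun k => h k / h (k + 1) := monotone_nat_of_le_succ hratio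
  have hup : ∀ k, h (r + k) * x ^ (r + k) ≤ h r * x ^ r * θ ^ k := by
    intro k
    induction k with
    | zero => simp
    | succ k ih =>
      have h1 : h (r + k + 1) * x ≤ θ * h (r + k) := by
        have := hmono (show r ≤ r + k by omega)
        simp only at this
        rw [hx, mul_left_comm]
        refine mul_le_mul_of_nonneg_left ?_ hθ0.le
        rw [le_div_iff₀ (hpos _)] at this
        linarith
      calc h (r + (k + 1)) * x ^ (r + (k + 1)) = h (r + k + 1) * x * x ^ (r + k) := by
            rw [← add_assoc, pow_succ]; ring
        _ ≤ θ * h (r + k) * x ^ (r + k) := mul_le_mul_of_nonneg_right h1 (by positivity)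
        _ = θ * (h (r + k) * x ^ (r + k)) := by ring
        _ ≤ θ * (h r * x ^ r * θ ^ k) := mul_le_mul_of_nonneg_left ih hθ0.le
        _ = _ := by rw [pow_succ]; ring
  have hdown : ∀ k ≤ r, h k * x ^ k * θ ^ (r - k) ≤ h r * x ^ r := by
    intro k hk
    refine Nat.decreasingInduction' (P := fun k => h k * x ^ k * θ ^ (r - k) ≤ h r * x ^ r)
      (fun q hq _ ih => le_trans ?_ ih) hk (by simp)
    have h1 : θ * h q ≤ h (q + 1) * x := by
      have := hmono hq.le
      simp only at this
      rw [hx, mul_left_comm]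
      refine mul_le_mul_of_nonneg_left ?_ hθ0.le
      rw [div_le_iff₀ (hpos _)] at this
      linarith
    rw [show r - q = r - (q + 1) + 1 by omega, pow_succ, pow_succ x]
    have := mul_le_mul_of_nonneg_right h1 (show 0 ≤ x ^ q * θ ^ (r - (q + 1)) by positivity)
    linarith
  have hbern : (1 : ℝ) / 2 ≤ θ ^ r := by
    have := one_add_mul_le_pow (a := -(1 / (2 * (r : ℝ)))) (by linarith) r
    rw [show 1 + -(1 / (2 * (r : ℝ))) = θ by rw [hθ]; ring] at this
    refine le_trans (le_of_eq ?_) this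
    field_simp; norm_num
  have hB : 0 < h r * x ^ r := mul_pos (hpos r) (by positivity)
  have hlow : ∑ k ∈ Finset.range r, h k * x ^ k ≤ 2 * r * (h r * x ^ r) := by
    refine (Finset.sum_le_card_nsmul _ _ (2 * (h r * x ^ r)) fun k hk => ?_).trans (le_of_eq ?_)
    · have h1 := hdown k (Finset.mem_range.mp hk).le
      have h2 : (1 : ℝ) / 2 ≤ θ ^ (r - k) :=
        hbern.trans (pow_le_pow_of_le_one hθ0.le hθ1.le (Nat.sub_le _ _))
      have h3 : 0 < h k * x ^ k := mul_pos (hpos k) (by positivity)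
      nlinarith
    · rw [Finset.card_range, nsmul_eq_mul]; ring
  have hhigh : ∑ k ∈ Finset.range M, h (r + k) * x ^ (r + k) ≤ 2 * r * (h r * x ^ r) := by
    refine (Finset.sum_le_sum fun k _ => hup k).trans ?_
    rw [← Finset.mul_sum, mul_comm]
    refine mul_le_mul_of_nonneg_right ?_ hB.le
    refine (Summable.sum_le_tsum _ (fun _ _ => by positivity)
      (summable_geometric_of_lt_one hθ0.le hθ1)).trans ?_
    rw [tsum_geometric_of_lt_one hθ0.le hθ1, hθ]
    simp
  calc ∑ k ∈ Finset.range M, h k * x ^ k ≤ ∑ k ∈ Finset.range (r + M), h k * x ^ k :=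
        Finset.sum_le_sum_of_subset_of_nonneg (Finset.range_subset_range.mpr (by omega))
          fun k _ _ => mul_nonneg (hpos k).le (by positivity)
    _ = _ := Finset.sum_range_add ..
    _ ≤ _ := by linarith

section Rows

variable {J : Type*} [Fintype J] [DecidableEq J] {y : J → ℝ}

lemma exists_prod_inv_le_completeSum [Nonempty J] (hy : ∀ l, 0 < y l) {r : ℕ} (hr : 0 < r) :
    ∃ x > 0, (∀ l, x * y l < 1) ∧
      ∏ l, (1 - x * y l)⁻¹ ≤ 4 * r * (completeSum y r * x ^ r) := by
  have hpos := completeSum_pos hy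
  have hr1 : (1 : ℝ) ≤ r := by exact_mod_cast hr
  have hθ1 : 1 - 1 / (2 * (r : ℝ)) < 1 := by
    have : 0 < 1 / (2 * (r : ℝ)) := by positivity
    linarith
  have hθ0 : 0 < 1 - 1 / (2 * (r : ℝ)) := by
    have : 1 / (2 * (r : ℝ)) ≤ 1 / 2 := one_div_le_one_div_of_le (by norm_num) (by linarith)
    linarith
  set x := (1 - 1 / (2 * (r : ℝ))) * (completeSum y r / completeSum y (r + 1)) with hx
  have hx0 : 0 < x := mul_pos hθ0 (div_pos (hpos _) (hpos _))
  have hxy : ∀ l, x * y l < 1 := fun l => by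
    have h1 : completeSum y r / completeSum y (r + 1) * y l ≤ 1 := by
      rw [div_mul_eq_mul_div, div_le_one (hpos _), mul_comm]
      exact mul_completeSum_le hy l r
    rw [hx, mul_assoc]
    have h2 : 0 < completeSum y r / completeSum y (r + 1) * y l :=
      mul_pos (div_pos (hpos _) (hpos _)) (hy l)
    nlinarith
  exact ⟨x, hx0, hxy, prod_inv_le_of_partialSum_le hy hx0 hxy
    (sum_range_le_of_logConcave hpos (completeSum_mul_le_sq hy) hr hx)⟩

variable {I : Type*} [Fintype I] [DecidableEq I] {K : ℕ} {r : I → ℕ} {c : J → ℕ}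

lemma tableSum_empty (hK : ∀ i, r i ≤ K) :
    tableSum K r c ∅ y = ∏ i, completeSum y (r i) := by
  simp only [completeSum]
  rw [Finset.prod_univ_sum, tableSum]
  refine Finset.sum_bij' (fun X _ i l => X (i, l)) (fun p _ e => p e.1 e.2) ?_ ?_ ?_ ?_ ?_
  · intro X hX
    simp only [tables, Finset.mem_filter] at hX
    simpa [Fintype.mem_piFinset] using hX.2.1
  · intro p hp
    simp only [Fintype.mem_piFinset, Finset.mem_piAntidiag] at hp
    simp only [tables, Finset.mem_filter, Fintype.mem_piFinset, Finset.mem_range]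
    refine ⟨fun e => ?_, fun i => (hp i).1, by simp⟩
    have h1 : ∑ l, p e.1 l = r e.1 := (hp e.1).1
    have h2 := Finset.single_le_sum (f := p e.1) (fun _ _ => Nat.zero_le _) (Finset.mem_univ e.2)
    have h3 := hK e.1
    rw [h1] at h2; omega
  · intro X _; rfl
  · intro p _; rfl
  · intro X _
    simp [Fintype.prod_prod_type, freeWeight]

lemma tableSum_univ (hK : ∀ i, r i ≤ K) :
    tableSum K r c Finset.univ y = Nat.card {D : Matrix I J ℕ //
        (∀ i, ∑ j, D i j = r i) ∧ (∀ j, ∑ i, D i j = c j)} := by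
  have h1 : tableSum K r c Finset.univ y = (tables K r c Finset.univ).card := by
    simp [tableSum, freeWeight]
  rw [h1, ← Nat.card_eq_finsetCard]
  congr 1
  refine Nat.card_congr (Equiv.subtypeEquiv (Equiv.curry I J ℕ) fun X => ?_)
  simp only [tables, Finset.mem_filter, Fintype.mem_piFinset, Finset.mem_range, Finset.mem_univ,
    forall_true_left]
  refine ⟨fun h => h.2, fun h => ⟨fun ⟨i, l⟩ => ?_, h⟩⟩
  have h2 := Finset.single_le_sum (f := fun l => X (i, l)) (fun _ _ => Nat.zero_le _)
    (Finset.mem_univ l)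
  have h3 := hK i
  have h4 : ∑ l, X (i, l) = r i := h.1 i
  omega

end Rows

section Count

variable {I J : Type*} [Fintype I] [Fintype J] [DecidableEq I] [DecidableEq J]

omit [DecidableEq I] [DecidableEq J] in
/-- A lower bound for the generating function on the open cube extends to all positive `x, y` with
`x i * y j < 1`, by homogeneity. -/
lemma mul_prod_pow_le_of_cube [Nonempty I] [Nonempty J] {r : I → ℕ} {c : J → ℕ}
    (hsum : ∑ i, r i = ∑ j, c j) {ρ : ℝ}
    (h : ∀ (x : I → ℝ) (y : J → ℝ), (∀ i, x i ∈ Set.Ioo (0 : ℝ) 1) →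
      (∀ j, y j ∈ Set.Ioo (0 : ℝ) 1) →
      ρ * (∏ i, x i ^ r i) * ∏ j, y j ^ c j ≤ ∏ i, ∏ j, (1 - x i * y j)⁻¹)
    {x : I → ℝ} {y : J → ℝ} (hx : ∀ i, 0 < x i) (hy : ∀ j, 0 < y j)
    (hxy : ∀ i j, x i * y j < 1) :
    ρ * (∏ i, x i ^ r i) * ∏ j, y j ^ c j ≤ ∏ i, ∏ j, (1 - x i * y j)⁻¹ := by
  obtain ⟨a, ha⟩ := Finite.exists_max x
  obtain ⟨b, hb⟩ := Finite.exists_max y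
  have hxa := hx a
  have hyb := hy b
  obtain ⟨s, hs1, hs2⟩ := exists_between (show y b < 1 / x a by
    rw [lt_div_iff₀ hxa, mul_comm]; exact hxy a b)
  have hs : 0 < s := hyb.trans hs1
  rw [lt_div_iff₀ hxa] at hs2
  have key := h (fun i => s * x i) (fun j => y j / s)
    (fun i => ⟨mul_pos hs (hx i), lt_of_le_of_lt (mul_le_mul_of_nonneg_left (ha i) hs.le) hs2⟩)
    (fun j => ⟨div_pos (hy j) hs, (div_lt_one hs).mpr ((hb j).trans_lt hs1)⟩)
  have e1 : ∀ i j, s * x i * (y j / s) = x i * y j := fun i j => by field_simp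
  simp only [e1, mul_pow, div_pow, Finset.prod_mul_distrib, Finset.prod_div_distrib,
    Finset.prod_pow_eq_pow_sum, hsum] at key
  refine le_trans (le_of_eq ?_) key
  have := (pow_pos hs (∑ j, c j)).ne'
  field_simp

theorem le_mul_card_tables [Nonempty I] [Nonempty J] {r : I → ℕ} {c : J → ℕ} (hr : ∀ i, 0 < r i)
    (hc : ∀ j, 0 < c j) (hsum : ∑ i, r i = ∑ j, c j) {ρ : ℝ}
    (h : ∀ (x : I → ℝ) (y : J → ℝ), (∀ i, x i ∈ Set.Ioo (0 : ℝ) 1) →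
      (∀ j, y j ∈ Set.Ioo (0 : ℝ) 1) →
      ρ * (∏ i, x i ^ r i) * ∏ j, y j ^ c j ≤ ∏ i, ∏ j, (1 - x i * y j)⁻¹) :
    ρ ≤ (∏ i, 4 * (r i : ℝ)) * ((∑ i, (r i : ℝ) + 1) ^ Fintype.card J *
      Nat.card {D : Matrix I J ℕ // (∀ i, ∑ j, D i j = r i) ∧ (∀ j, ∑ i, D i j = c j)}) := by
  have hK : ∀ i, r i ≤ ∑ i, r i := fun i =>
    Finset.single_le_sum (fun _ _ => Nat.zero_le _) (Finset.mem_univ i)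
  have hP : 0 < ∏ i, 4 * (r i : ℝ) :=
    Finset.prod_pos fun i _ => mul_pos four_pos (by exact_mod_cast hr i)
  have key := le_tableSum (y := fun _ => 1) hK hc hsum.symm (δ := ρ / ∏ i, 4 * (r i : ℝ)) ?_
    Finset.univ (fun _ => one_pos)
  · rw [tableSum_univ hK] at key
    simp only [freeWeight, Finset.mem_univ, if_true, one_pow, Finset.prod_const_one, mul_one,
      Finset.card_univ] at key
    rwa [div_le_iff₀' hP] at key
  · intro y hy
    choose x hx hxy hle using fun i => exists_prod_inv_le_completeSum hy (hr i)
    have h1 := (mul_prod_pow_le_of_cube hsum h hx hy hxy).trans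
      (Finset.prod_le_prod (fun i _ => Finset.prod_nonneg fun j _ =>
        inv_nonneg.mpr (sub_nonneg.mpr (hxy i j).le)) fun i _ => hle i)
    rw [Finset.prod_mul_distrib (f := fun i => 4 * (r i : ℝ)),
      Finset.prod_mul_distrib (f := fun i => completeSum y (r i)), ← tableSum_empty (c := c) hK] at h1
    rw [div_mul_eq_mul_div, div_le_iff₀' hP]
    have hxp : 0 < ∏ i, x i ^ r i := Finset.prod_pos fun i _ => pow_pos (hx i) _
    refine le_of_mul_le_mul_right ?_ hxp
    linarith

end Count

lemma prod_pow_div_factorial_le {ι : Type*} [Fintype ι] [DecidableEq ι] (r : ι → ℕ) :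
    ∏ i, (r i : ℝ) ^ r i / (r i).factorial ≤
      ((∑ i, r i : ℕ) : ℝ) ^ (∑ i, r i) / (∑ i, r i).factorial := by
  rw [Finset.prod_div_distrib, div_le_div_iff₀
    (Finset.prod_pos fun i _ => by exact_mod_cast Nat.factorial_pos _)
    (by exact_mod_cast Nat.factorial_pos _)]
  have h1 : Nat.multinomial Finset.univ r * ∏ i, r i ^ r i ≤ (∑ i, r i) ^ (∑ i, r i) := by
    rw [Finset.sum_pow_eq_sum_piAntidiag]
    exact Finset.single_le_sum (f := fun k => Nat.multinomial Finset.univ k * ∏ i, r i ^ k i)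
      (fun _ _ => Nat.zero_le _) (by simp)
  have h2 := Nat.multinomial_spec Finset.univ r
  have h3 : (∏ i, r i ^ r i) * (∑ i, r i).factorial ≤
      (∑ i, r i) ^ (∑ i, r i) * ∏ i, (r i).factorial := by
    rw [← h2]
    calc _ = (Nat.multinomial Finset.univ r * ∏ i, r i ^ r i) * ∏ i, (r i).factorial := by ring
      _ ≤ _ := Nat.mul_le_mul_right _ h1
  exact_mod_cast h3

lemma factorial_factor_le_one {m n N : ℕ} (hN : 0 < N) (hp : 0 < m * n) {r : Fin m → ℕ}
    {c : Fin n → ℕ} (hrN : ∑ i, r i = N) (hcN : ∑ j, c j = N) :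
    (∏ i, (r i : ℝ) ^ (r i) / (Nat.factorial (r i) : ℝ)) *
      (∏ j, (c j : ℝ) ^ (c j) / (Nat.factorial (c j) : ℝ)) *
      ((Nat.factorial N : ℝ) * (Nat.factorial (N + m * n) : ℝ) * ((m : ℝ) * n) ^ (m * n) /
        ((N : ℝ) ^ N * ((N : ℝ) + m * n) ^ (N + m * n) * (Nat.factorial (m * n) : ℝ))) ≤ 1 := by
  have h1 := prod_pow_div_factorial_le r
  have h2 := prod_pow_div_factorial_le fun o : Option (Fin n) => o.elim (m * n) c
  simp only [Fintype.prod_option, Fintype.sum_option, Option.elim_none, Option.elim_some, hcN] at h2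
  rw [hrN] at h1
  push_cast at h2
  have hNr : (0 : ℝ) < N := by exact_mod_cast hN
  have hpr : (0 : ℝ) < m * n := by exact_mod_cast hp
  have hf : ∀ k : ℕ, (0 : ℝ) < k.factorial := fun k => by exact_mod_cast Nat.factorial_pos k
  have hA : 0 ≤ ∏ i, (r i : ℝ) ^ (r i) / (Nat.factorial (r i) : ℝ) :=
    Finset.prod_nonneg fun _ _ => by positivity
  have hB : 0 ≤ ∏ j, (c j : ℝ) ^ (c j) / (Nat.factorial (c j) : ℝ) :=
    Finset.prod_nonneg fun _ _ => by positivity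
  rw [add_comm (m * n) N, add_comm ((m : ℝ) * n) N] at h2
  set A := ∏ i, (r i : ℝ) ^ (r i) / (Nat.factorial (r i) : ℝ)
  set B := ∏ j, (c j : ℝ) ^ (c j) / (Nat.factorial (c j) : ℝ)
  have f1 := hf N
  have f2 := hf (N + m * n)
  have f3 := hf (m * n)
  have h3 := mul_le_mul h1 h2 (by positivity) (by positivity)
  have hX : 0 < (N : ℝ) ^ N / N.factorial *
      (((N : ℝ) + m * n) ^ (N + m * n) / (N + m * n).factorial) := by positivity
  calc _ = A * (((m : ℝ) * n) ^ (m * n) / (m * n).factorial * B) / ((N : ℝ) ^ N / N.factorial *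
      (((N : ℝ) + m * n) ^ (N + m * n) / (N + m * n).factorial)) := by field_simp
    _ ≤ 1 := (div_le_one hX).mpr h3

lemma gamma_factor_le {m n N : ℕ} (hm : 1 < m) (hn : 1 < n) (hmn : 10 ≤ m + n) :
    (Real.Gamma (((m : ℝ) + n) / 2) /
        (2 * Real.exp 5 * Real.pi ^ (((m : ℝ) + n - 2) / 2) * m * n * ((N : ℝ) + m * n))) *
      (2 / (((m : ℝ) * n) ^ 2 * ((N : ℝ) + 1) * ((N : ℝ) + m * n))) ^ (m + n - 1) ≤
      (1 / (4 * ((N : ℝ) + 1))) ^ (m + n) := by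
  obtain ⟨s, hs⟩ : ∃ s, m + n = s + 1 := ⟨m + n - 1, by omega⟩
  have hsp : s ≤ m * n := by nlinarith
  have hp16 : 16 ≤ m * n := by
    rcases le_or_gt m 4 with h | h
    · interval_cases m <;> omega
    · rcases le_or_gt n 4 with h' | h'
      · interval_cases n <;> omega
      · nlinarith
  have hsr : (m : ℝ) + n = s + 1 := by exact_mod_cast hs
  have hs9 : (9 : ℝ) ≤ s := by exact_mod_cast (by omega : 9 ≤ s)
  set p : ℝ := (m : ℝ) * n with hp
  have hpr : (16 : ℝ) ≤ p := by rw [hp]; exact_mod_cast hp16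
  have hp0 : 0 < p := by linarith
  have hspr : (s : ℝ) ≤ p := by rw [hp]; exact_mod_cast hsp
  have hNr : (0 : ℝ) ≤ N := Nat.cast_nonneg N
  have hΓ : Real.Gamma (((m : ℝ) + n) / 2) ≤ p ^ s := by
    rw [hsr]
    calc Real.Gamma (((s : ℝ) + 1) / 2) ≤ Real.Gamma (s + 1) :=
          Real.Gamma_strictMonoOn_Ici.monotoneOn (Set.mem_Ici.mpr (by linarith))
            (Set.mem_Ici.mpr (by linarith)) (by linarith)
      _ = s.factorial := Real.Gamma_nat_eq_factorial s
      _ ≤ (s : ℝ) ^ s := by exact_mod_cast Nat.factorial_le_pow s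
      _ ≤ p ^ s := pow_le_pow_left₀ (by linarith) hspr s
  have hden : p * (N + p) ≤
      2 * Real.exp 5 * Real.pi ^ (((m : ℝ) + n - 2) / 2) * m * n * ((N : ℝ) + p) := by
    have h1 : 1 ≤ Real.exp 5 := Real.one_le_exp (by norm_num)
    have h2 : 1 ≤ Real.pi ^ (((m : ℝ) + n - 2) / 2) :=
      Real.one_le_rpow (by linarith [Real.pi_gt_three]) (by rw [hsr]; linarith)
    have h3 : 1 ≤ 2 * Real.exp 5 * Real.pi ^ (((m : ℝ) + n - 2) / 2) :=
      one_le_mul_of_one_le_of_one_le (by linarith) h2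
    exact (le_mul_of_one_le_left (show 0 ≤ p * (N + p) by positivity) h3).trans_eq (by rw [hp]; ring)
  rw [hs, Nat.add_sub_cancel, pow_succ' (1 / (4 * ((N : ℝ) + 1)))]
  calc _ ≤ p ^ s / (p * (N + p)) * (2 / (p ^ 2 * ((N : ℝ) + 1) * ((N : ℝ) + p))) ^ s := by
        refine mul_le_mul_of_nonneg_right ?_ (pow_nonneg (by positivity) _)
        exact div_le_div₀ (pow_nonneg (by linarith) s) hΓ (by positivity) hden
    _ = 1 / (p * (N + p)) * (2 / (p * ((N : ℝ) + 1) * ((N : ℝ) + p))) ^ s := by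
        rw [div_mul_eq_mul_div, ← mul_pow, div_eq_mul_one_div, mul_comm]
        congr 2
        field_simp
    _ ≤ _ := by
        refine mul_le_mul ?_ (pow_le_pow_left₀ (by positivity) ?_ s) (by positivity) (by positivity)
        · exact one_div_le_one_div_of_le (by positivity) (by nlinarith)
        · rw [div_le_div_iff₀ (by positivity) (by positivity)]
          nlinarith [mul_nonneg hNr hNr, mul_le_mul hpr (show (16 : ℝ) ≤ N + p by linarith)
            (by norm_num) (by linarith)]

/-- Explicit lower bound for the number of contingency tables in terms
of `ρ(R,C)`, valid when `m + n ≥ 10`. -/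
theorem contingency_count_lower_bound
    (m n N : ℕ) (hm : 1 < m) (hn : 1 < n) (hmn : 10 ≤ m + n)
    (r : Fin m → ℕ) (c : Fin n → ℕ)
    (hr : ∀ i, 0 < r i) (hc : ∀ j, 0 < c j)
    (hrN : ∑ i, r i = N) (hcN : ∑ j, c j = N)
    (ρ : ℝ)
    (hρ : IsLeast {z : ℝ | ∃ (x : Fin m → ℝ) (y : Fin n → ℝ),
      (∀ i, x i ∈ Set.Ioo (0 : ℝ) 1) ∧ (∀ j, y j ∈ Set.Ioo (0 : ℝ) 1) ∧
      (∏ i, x i ^ (-(r i : ℤ))) * (∏ j, y j ^ (-(c j : ℤ))) *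
        (∏ i, ∏ j, (1 - x i * y j)⁻¹) = z} ρ) :
    (Nat.card {D : Matrix (Fin m) (Fin n) ℕ //
        (∀ i, ∑ j, D i j = r i) ∧ (∀ j, ∑ i, D i j = c j)} : ℝ) ≥
      (Real.Gamma (((m : ℝ) + n) / 2) /
          (2 * Real.exp 5 * Real.pi ^ (((m : ℝ) + n - 2) / 2) * m * n * ((N : ℝ) + m * n))) *
        (2 / (((m : ℝ) * n) ^ 2 * ((N : ℝ) + 1) * ((N : ℝ) + m * n))) ^ (m + n - 1) *
        (∏ i, (r i : ℝ) ^ (r i) / (Nat.factorial (r i) : ℝ)) *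
        (∏ j, (c j : ℝ) ^ (c j) / (Nat.factorial (c j) : ℝ)) *
        ((Nat.factorial N : ℝ) * (Nat.factorial (N + m * n) : ℝ) * ((m : ℝ) * n) ^ (m * n) /
          ((N : ℝ) ^ N * ((N : ℝ) + m * n) ^ (N + m * n) * (Nat.factorial (m * n) : ℝ))) *
        ρ := by
  have : Nonempty (Fin m) := ⟨⟨0, by omega⟩⟩
  have : Nonempty (Fin n) := ⟨⟨0, by omega⟩⟩
  have hrle : ∀ i, r i ≤ N := fun i =>
    hrN ▸ Finset.single_le_sum (fun _ _ => Nat.zero_le _) (Finset.mem_univ i)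
  have hN : 0 < N := (hr ⟨0, by omega⟩).trans_le (hrle _)
  have hρ0 : 0 ≤ ρ := by
    obtain ⟨x, y, hx, hy, rfl⟩ := hρ.1
    refine mul_nonneg (mul_nonneg (Finset.prod_nonneg fun i _ => zpow_nonneg (hx i).1.le _)
      (Finset.prod_nonneg fun j _ => zpow_nonneg (hy j).1.le _))
      (Finset.prod_nonneg fun i _ => Finset.prod_nonneg fun j _ => inv_nonneg.mpr ?_)
    nlinarith [(hx i).1, (hx i).2, (hy j).1, (hy j).2]
  have key := le_mul_card_tables hr hc (hrN.trans hcN.symm) (ρ := ρ) fun x y hx hy => by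
    have h := hρ.2 ⟨x, y, hx, hy, rfl⟩
    simp only [zpow_neg, zpow_natCast, Finset.prod_inv_distrib] at h ⊢
    have hX : 0 < ∏ i, x i ^ r i := Finset.prod_pos fun i _ => pow_pos (hx i).1 _
    have hY : 0 < ∏ j, y j ^ c j := Finset.prod_pos fun j _ => pow_pos (hy j).1 _
    rwa [← mul_inv, inv_mul_eq_div, le_div_iff₀ (mul_pos hX hY), ← mul_assoc] at h
  have hrNr : ∑ i, (r i : ℝ) = N := by exact_mod_cast hrN
  rw [hrNr, Fintype.card_fin] at key
  set T : ℝ := ((Nat.card {D : Matrix (Fin m) (Fin n) ℕ //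
        (∀ i, ∑ j, D i j = r i) ∧ (∀ j, ∑ i, D i j = c j)} : ℕ) : ℝ)
  have hT : 0 ≤ T := Nat.cast_nonneg _
  have hNr : (0 : ℝ) ≤ N := Nat.cast_nonneg N
  have hP : (∏ i, 4 * (r i : ℝ)) ≤ (4 * ((N : ℝ) + 1)) ^ m := by
    refine (Finset.prod_le_prod (fun i _ => by positivity) (g := fun _ => 4 * ((N : ℝ) + 1))
      fun i _ => ?_).trans (by simp)
    have : (r i : ℝ) ≤ N := by exact_mod_cast hrle i
    linarith
  have hρT : ρ ≤ (4 * ((N : ℝ) + 1)) ^ (m + n) * T := by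
    refine key.trans ?_
    rw [pow_add, mul_assoc]
    refine mul_le_mul hP (mul_le_mul_of_nonneg_right
      (pow_le_pow_left₀ (by positivity) (by linarith) n) hT) (by positivity) (by positivity)
  have hG := gamma_factor_le (N := N) hm hn hmn
  have hF := factorial_factor_le_one hN (by positivity) hrN hcN
  have hF0 : 0 ≤ (∏ i, (r i : ℝ) ^ (r i) / (Nat.factorial (r i) : ℝ)) *
      (∏ j, (c j : ℝ) ^ (c j) / (Nat.factorial (c j) : ℝ)) *
      ((Nat.factorial N : ℝ) * (Nat.factorial (N + m * n) : ℝ) * ((m : ℝ) * n) ^ (m * n) /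
        ((N : ℝ) ^ N * ((N : ℝ) + m * n) ^ (N + m * n) * (Nat.factorial (m * n) : ℝ))) :=
    mul_nonneg (mul_nonneg (Finset.prod_nonneg fun _ _ => by positivity)
      (Finset.prod_nonneg fun _ _ => by positivity)) (by positivity)
  have hGF := mul_le_mul hG hF hF0 (by positivity)
  rw [ge_iff_le]
  calc _ ≤ (1 / (4 * ((N : ℝ) + 1))) ^ (m + n) * 1 * ρ := by
        refine le_trans (le_of_eq ?_) (mul_le_mul_of_nonneg_right hGF hρ0)
        ring
    _ ≤ (1 / (4 * ((N : ℝ) + 1))) ^ (m + n) * 1 * ((4 * ((N : ℝ) + 1)) ^ (m + n) * T) :=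
        mul_le_mul_of_nonneg_left hρT (by positivity)
    _ = T := by
        rw [mul_one, ← mul_assoc, ← mul_pow, one_div_mul_cancel (by positivity), one_pow, one_mul]
end
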